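/- arXiv:2601.12665 — 5 statements merged into one kernel-verified Lean document; each statement's English description precedes it below -/
import Mathlib

section
/- Let r ∈ (0,1), p ≥ 0, q ≥ 0 with p + q ≤ 1 and p + q > 0, and homophily parameters h_R, h_B ∈ (0,1). Then there exists δ₀ > 0 such that for every δ > δ₀ and every θ = (θ_in, θ_out) ∈ [0,1]², all four denominators appearing in the definition of the DMPA limit map F (namely T − Ā_in h_B − A_in (1−h_R), T − Ā_in (1−h_B) − A_in h_R, T − Ā_out h_R − A_out (1−h_R), T − Ā_out (1−h_B) − A_out h_B, and D₃) are strictly positive, each of the quantities p1RR, p1BR, p2RR, p2BR, p3RR, p3BR, p3RB lies in the interval [0,1], and F maps [0,1]² into [0,1]². -/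
open Set Filter

noncomputable section

/-- `s = (p+q)δ` in the DMPA limit map. -/
def dmpaS (p q δ : ℝ) : ℝ := (p + q) * δ

/-- `T = 1 + s` in the DMPA limit map. -/
def dmpaT (p q δ : ℝ) : ℝ := 1 + dmpaS p q δ

/-- `A_in = θ_in + r s`. -/
def dmpaAin (r p q δ θin : ℝ) : ℝ := θin + r * dmpaS p q δ

/-- `Ā_in = 1 − θ_in + (1−r) s`. -/
def dmpaAbin (r p q δ θin : ℝ) : ℝ := 1 - θin + (1 - r) * dmpaS p q δ

/-- `A_out = θ_out + r s`. -/
def dmpaAout (r p q δ θout : ℝ) : ℝ := θout + r * dmpaS p q δ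

/-- `Ā_out = 1 − θ_out + (1−r) s`. -/
def dmpaAbout (r p q δ θout : ℝ) : ℝ := 1 - θout + (1 - r) * dmpaS p q δ

/-- Denominator `T − Ā_in h_B − A_in (1−h_R)` of `p1RR`. -/
def dmpaDen1RR (r p q hR hB δ θin : ℝ) : ℝ :=
  dmpaT p q δ - dmpaAbin r p q δ θin * hB - dmpaAin r p q δ θin * (1 - hR)

/-- Denominator `T − Ā_in (1−h_B) − A_in h_R` of `p1BR`. -/
def dmpaDen1BR (r p q hR hB δ θin : ℝ) : ℝ :=
  dmpaT p q δ - dmpaAbin r p q δ θin * (1 - hB) - dmpaAin r p q δ θin * hR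

/-- Denominator `T − Ā_out h_R − A_out (1−h_R)` of `p2RR`. -/
def dmpaDen2RR (r p q hR δ θout : ℝ) : ℝ :=
  dmpaT p q δ - dmpaAbout r p q δ θout * hR - dmpaAout r p q δ θout * (1 - hR)

/-- Denominator `T − Ā_out (1−h_B) − A_out h_B` of `p2BR`. -/
def dmpaDen2BR (r p q hB δ θout : ℝ) : ℝ :=
  dmpaT p q δ - dmpaAbout r p q δ θout * (1 - hB) - dmpaAout r p q δ θout * hB

/-- Denominator `D₃` of the event-3 probabilities. -/
def dmpaD3 (r p q hR hB δ θin θout : ℝ) : ℝ :=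
  (dmpaT p q δ) ^ 2
    - dmpaAbout r p q δ θout * dmpaAbin r p q δ θin * (1 - hB)
    - dmpaAbout r p q δ θout * dmpaAin r p q δ θin * hR
    - dmpaAout r p q δ θout * dmpaAbin r p q δ θin * hB
    - dmpaAout r p q δ θout * dmpaAin r p q δ θin * (1 - hR)

/-- `p1RR = A_in h_R / (T − Ā_in h_B − A_in (1−h_R))`. -/
def dmpaP1RR (r p q hR hB δ θin : ℝ) : ℝ :=
  dmpaAin r p q δ θin * hR / dmpaDen1RR r p q hR hB δ θin

/-- `p1BR = A_in (1−h_R) / (T − Ā_in (1−h_B) − A_in h_R)`. -/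
def dmpaP1BR (r p q hR hB δ θin : ℝ) : ℝ :=
  dmpaAin r p q δ θin * (1 - hR) / dmpaDen1BR r p q hR hB δ θin

/-- `p2RR = A_out h_R / (T − Ā_out h_R − A_out (1−h_R))`. -/
def dmpaP2RR (r p q hR δ θout : ℝ) : ℝ :=
  dmpaAout r p q δ θout * hR / dmpaDen2RR r p q hR δ θout

/-- `p2BR = A_out (1−h_B) / (T − Ā_out (1−h_B) − A_out h_B)`. -/
def dmpaP2BR (r p q hB δ θout : ℝ) : ℝ :=
  dmpaAout r p q δ θout * (1 - hB) / dmpaDen2BR r p q hB δ θout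

/-- `p3RR = A_out A_in h_R / D₃`. -/
def dmpaP3RR (r p q hR hB δ θin θout : ℝ) : ℝ :=
  dmpaAout r p q δ θout * dmpaAin r p q δ θin * hR / dmpaD3 r p q hR hB δ θin θout

/-- `p3BR = Ā_out A_in (1−h_R) / D₃`. -/
def dmpaP3BR (r p q hR hB δ θin θout : ℝ) : ℝ :=
  dmpaAbout r p q δ θout * dmpaAin r p q δ θin * (1 - hR) / dmpaD3 r p q hR hB δ θin θout

/-- `p3RB = A_out Ā_in (1−h_B) / D₃`. -/
def dmpaP3RB (r p q hR hB δ θin θout : ℝ) : ℝ :=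
  dmpaAout r p q δ θout * dmpaAbin r p q δ θin * (1 - hB) / dmpaD3 r p q hR hB δ θin θout

/-- The DMPA limit map `F : [0,1]² → ℝ²`,
`F₁(θ) = p (r·p1RR + (1−r)·p1BR) + q r + (1−p−q)(p3RR + p3BR)`,
`F₂(θ) = p r + q (r·p2RR + (1−r)·p2BR) + (1−p−q)(p3RR + p3RB)`. -/
def dmpaF (r p q hR hB δ : ℝ) (θ : ℝ × ℝ) : ℝ × ℝ :=
  (p * (r * dmpaP1RR r p q hR hB δ θ.1 + (1 - r) * dmpaP1BR r p q hR hB δ θ.1)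
      + q * r
      + (1 - p - q) * (dmpaP3RR r p q hR hB δ θ.1 θ.2 + dmpaP3BR r p q hR hB δ θ.1 θ.2),
    p * r
      + q * (r * dmpaP2RR r p q hR δ θ.2 + (1 - r) * dmpaP2BR r p q hB δ θ.2)
      + (1 - p - q) * (dmpaP3RR r p q hR hB δ θ.1 θ.2 + dmpaP3RB r p q hR hB δ θ.1 θ.2))

/-- A quotient whose numerator is nonnegative and at most the positive denominator is in `[0,1]`. -/
lemma div_mem_Icc_zero_one {x y : ℝ} (hx : 0 ≤ x) (hy : 0 < y) (hxy : x ≤ y) :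
    x / y ∈ Icc (0 : ℝ) 1 :=
  ⟨div_nonneg hx hy.le, div_le_one_of_le₀ hxy hy.le⟩

/-- The interval `[0,1]` is closed under convex combinations of two points. -/
lemma convex_comb_mem_Icc_zero_one {t x y : ℝ} (ht : t ∈ Icc (0 : ℝ) 1)
    (hx : x ∈ Icc (0 : ℝ) 1) (hy : y ∈ Icc (0 : ℝ) 1) :
    t * x + (1 - t) * y ∈ Icc (0 : ℝ) 1 :=
  convex_Icc 0 1 hx hy ht.1 (sub_nonneg.2 ht.2) (by ring)

/-- The interval `[0,1]` is closed under convex combinations of three points. -/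
lemma convex_comb_three_mem_Icc_zero_one {p q x y z : ℝ} (hp : 0 ≤ p) (hq : 0 ≤ q)
    (hpq : p + q ≤ 1) (hx : x ∈ Icc (0 : ℝ) 1) (hy : y ∈ Icc (0 : ℝ) 1)
    (hz : z ∈ Icc (0 : ℝ) 1) :
    p * x + q * y + (1 - p - q) * z ∈ Icc (0 : ℝ) 1 := by
  have hw : 0 ≤ 1 - p - q := by linarith
  constructor
  · have := mul_nonneg hp hx.1
    have := mul_nonneg hq hy.1
    have := mul_nonneg hw hz.1
    linarith
  · have := mul_le_mul_of_nonneg_left hx.2 hp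
    have := mul_le_mul_of_nonneg_left hy.2 hq
    have := mul_le_mul_of_nonneg_left hz.2 hw
    linarith

/-- For `r ∈ (0,1)`, `p, q ≥ 0` with `p + q ≤ 1`, `p + q > 0`, and
`h_R, h_B ∈ (0,1)`, there exists `δ₀ > 0` such that for all `δ > δ₀` and all
`θ = (θ_in, θ_out) ∈ [0,1]²`, all denominators of the DMPA limit map are strictly positive,
each of the quantities `p1RR, p1BR, p2RR, p2BR, p3RR, p3BR, p3RB` lies in `[0,1]`, and `F`
maps `[0,1]²` into `[0,1]²`. -/
theorem dmpa_denominators_pos_probs_in_unit_interval_and_maps_into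
    (r p q hR hB : ℝ)
    (hr : r ∈ Ioo (0 : ℝ) 1) (hp : 0 ≤ p) (hq : 0 ≤ q)
    (hpq : p + q ≤ 1) (hpq0 : 0 < p + q)
    (hhR : hR ∈ Ioo (0 : ℝ) 1) (hhB : hB ∈ Ioo (0 : ℝ) 1) :
    ∃ δ₀ > (0 : ℝ), ∀ δ > δ₀, ∀ θin ∈ Icc (0 : ℝ) 1, ∀ θout ∈ Icc (0 : ℝ) 1,
      0 < dmpaDen1RR r p q hR hB δ θin ∧
      0 < dmpaDen1BR r p q hR hB δ θin ∧
      0 < dmpaDen2RR r p q hR δ θout ∧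
      0 < dmpaDen2BR r p q hB δ θout ∧
      0 < dmpaD3 r p q hR hB δ θin θout ∧
      dmpaP1RR r p q hR hB δ θin ∈ Icc (0 : ℝ) 1 ∧
      dmpaP1BR r p q hR hB δ θin ∈ Icc (0 : ℝ) 1 ∧
      dmpaP2RR r p q hR δ θout ∈ Icc (0 : ℝ) 1 ∧
      dmpaP2BR r p q hB δ θout ∈ Icc (0 : ℝ) 1 ∧
      dmpaP3RR r p q hR hB δ θin θout ∈ Icc (0 : ℝ) 1 ∧
      dmpaP3BR r p q hR hB δ θin θout ∈ Icc (0 : ℝ) 1 ∧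
      dmpaP3RB r p q hR hB δ θin θout ∈ Icc (0 : ℝ) 1 ∧
      dmpaF r p q hR hB δ (θin, θout) ∈ Icc (0 : ℝ) 1 ×ˢ Icc (0 : ℝ) 1 := by
  refine ⟨1, one_pos, fun δ hδ θin hin θout hout => ?_⟩
  have hs : 0 < dmpaS p q δ := mul_pos hpq0 (one_pos.trans hδ)
  have hrs : 0 < r * dmpaS p q δ := mul_pos hr.1 hs
  have hrs' : 0 < (1 - r) * dmpaS p q δ := mul_pos (sub_pos.2 hr.2) hs
  have ha : 0 < dmpaAin r p q δ θin := add_pos_of_nonneg_of_pos hin.1 hrs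
  have hb : 0 < dmpaAbin r p q δ θin := add_pos_of_nonneg_of_pos (sub_nonneg.2 hin.2) hrs'
  have hc : 0 < dmpaAout r p q δ θout := add_pos_of_nonneg_of_pos hout.1 hrs
  have hd : 0 < dmpaAbout r p q δ θout := add_pos_of_nonneg_of_pos (sub_nonneg.2 hout.2) hrs'
  have hTin : dmpaT p q δ = dmpaAin r p q δ θin + dmpaAbin r p q δ θin := by
    unfold dmpaT dmpaAin dmpaAbin; ring
  have hTout : dmpaT p q δ = dmpaAout r p q δ θout + dmpaAbout r p q δ θout := by
    unfold dmpaT dmpaAout dmpaAbout; ring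
  -- Each denominator is a sum of positive terms, since `T = A + Ā`.
  have e1RR : dmpaDen1RR r p q hR hB δ θin =
      dmpaAin r p q δ θin * hR + dmpaAbin r p q δ θin * (1 - hB) := by
    rw [dmpaDen1RR, hTin]; ring
  have e1BR : dmpaDen1BR r p q hR hB δ θin =
      dmpaAin r p q δ θin * (1 - hR) + dmpaAbin r p q δ θin * hB := by
    rw [dmpaDen1BR, hTin]; ring
  have e2RR : dmpaDen2RR r p q hR δ θout =
      dmpaAout r p q δ θout * hR + dmpaAbout r p q δ θout * (1 - hR) := by
    rw [dmpaDen2RR, hTout]; ring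
  have e2BR : dmpaDen2BR r p q hB δ θout =
      dmpaAout r p q δ θout * (1 - hB) + dmpaAbout r p q δ θout * hB := by
    rw [dmpaDen2BR, hTout]; ring
  have e3 : dmpaD3 r p q hR hB δ θin θout =
      dmpaAout r p q δ θout * dmpaAin r p q δ θin * hR
        + dmpaAbout r p q δ θout * dmpaAin r p q δ θin * (1 - hR)
        + dmpaAout r p q δ θout * dmpaAbin r p q δ θin * (1 - hB)
        + dmpaAbout r p q δ θout * dmpaAbin r p q δ θin * hB := by
    rw [dmpaD3, sq]; nth_rw 1 [hTout]; rw [hTin]; ring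
  have hR0 := hhR.1
  have hB0 := hhB.1
  have hR1 : 0 < 1 - hR := sub_pos.2 hhR.2
  have hB1 : 0 < 1 - hB := sub_pos.2 hhB.2
  have d1RR : 0 < dmpaDen1RR r p q hR hB δ θin := by rw [e1RR]; positivity
  have d1BR : 0 < dmpaDen1BR r p q hR hB δ θin := by rw [e1BR]; positivity
  have d2RR : 0 < dmpaDen2RR r p q hR δ θout := by rw [e2RR]; positivity
  have d2BR : 0 < dmpaDen2BR r p q hB δ θout := by rw [e2BR]; positivity
  have d3 : 0 < dmpaD3 r p q hR hB δ θin θout := by rw [e3]; positivity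
  have m1RR : dmpaP1RR r p q hR hB δ θin ∈ Icc (0 : ℝ) 1 :=
    div_mem_Icc_zero_one (by positivity) d1RR
      (by rw [e1RR]; exact le_add_of_nonneg_right (by positivity))
  have m1BR : dmpaP1BR r p q hR hB δ θin ∈ Icc (0 : ℝ) 1 :=
    div_mem_Icc_zero_one (by positivity) d1BR
      (by rw [e1BR]; exact le_add_of_nonneg_right (by positivity))
  have m2RR : dmpaP2RR r p q hR δ θout ∈ Icc (0 : ℝ) 1 :=
    div_mem_Icc_zero_one (by positivity) d2RR
      (by rw [e2RR]; exact le_add_of_nonneg_right (by positivity))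
  have m2BR : dmpaP2BR r p q hB δ θout ∈ Icc (0 : ℝ) 1 :=
    div_mem_Icc_zero_one (by positivity) d2BR
      (by rw [e2BR]; exact le_add_of_nonneg_right (by positivity))
  have n3RR : 0 < dmpaAout r p q δ θout * dmpaAin r p q δ θin * hR := by positivity
  have n3BR : 0 < dmpaAbout r p q δ θout * dmpaAin r p q δ θin * (1 - hR) := by positivity
  have n3RB : 0 < dmpaAout r p q δ θout * dmpaAbin r p q δ θin * (1 - hB) := by positivity
  have n3BB : 0 < dmpaAbout r p q δ θout * dmpaAbin r p q δ θin * hB := by positivity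
  have m3in : dmpaP3RR r p q hR hB δ θin θout + dmpaP3BR r p q hR hB δ θin θout
      ∈ Icc (0 : ℝ) 1 := by
    rw [dmpaP3RR, dmpaP3BR, ← add_div]
    exact div_mem_Icc_zero_one (by linarith) d3 (by linarith)
  have m3out : dmpaP3RR r p q hR hB δ θin θout + dmpaP3RB r p q hR hB δ θin θout
      ∈ Icc (0 : ℝ) 1 := by
    rw [dmpaP3RR, dmpaP3RB, ← add_div]
    exact div_mem_Icc_zero_one (by linarith) d3 (by linarith)
  have hr' : r ∈ Icc (0 : ℝ) 1 := Ioo_subset_Icc_self hr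
  exact ⟨d1RR, d1BR, d2RR, d2BR, d3, m1RR, m1BR, m2RR, m2BR,
    div_mem_Icc_zero_one n3RR.le d3 (by linarith),
    div_mem_Icc_zero_one n3BR.le d3 (by linarith),
    div_mem_Icc_zero_one n3RB.le d3 (by linarith),
    convex_comb_three_mem_Icc_zero_one hp hq hpq
      (convex_comb_mem_Icc_zero_one hr' m1RR m1BR) hr' m3in,
    convex_comb_three_mem_Icc_zero_one hp hq hpq hr'
      (convex_comb_mem_Icc_zero_one hr' m2RR m2BR) m3out⟩
end
end

section
/- Let r ∈ (0,1), p ≥ 0, q ≥ 0 with p + q ≤ 1 and p + q > 0, and homophily parameters h_R, h_B ∈ (0,1). Then there exists δ* > 0 such that for every δ > δ*, the DMPA limit map F maps [0,1]² into [0,1]² and is a contraction on [0,1]² with respect to the Euclidean norm: there exists L < 1 with ‖F(θ) − F(θ')‖ ≤ L ‖θ − θ'‖ for all θ, θ' ∈ [0,1]². Consequently, F has a unique fixed point θ* = (θ*_in, θ*_out) ∈ [0,1]², and for every initial point θ₀ ∈ [0,1]² the iterates defined by θ_{k+1} = F(θ_k) converge to θ* as k → ∞. -/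
open Set Filter

noncomputable section

/-- The Euclidean norm of the difference of two points of `ℝ²` (represented as `ℝ × ℝ`). -/
def euclidDist (a b : ℝ × ℝ) : ℝ :=
  Real.sqrt ((a.1 - b.1) ^ 2 + (a.2 - b.2) ^ 2)

/-- The affine map `x ↦ (x + r s) / (1 + s)`, which sends `A / T` at `δ` to `A / T` at `δ = 0`. -/
def dmpaShrink (r p q δ x : ℝ) : ℝ := dmpaAin r p q δ x / dmpaT p q δ

theorem dmpaF_eq_dmpaF_zero_shrink {r p q hR hB δ : ℝ} (hT : dmpaT p q δ ≠ 0) (θ : ℝ × ℝ) :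
    dmpaF r p q hR hB δ θ =
      dmpaF r p q hR hB 0 (Prod.map (dmpaShrink r p q δ) (dmpaShrink r p q δ) θ) := by
  obtain ⟨a, b⟩ := θ
  have key : ∀ x : ℝ, ∃ u : ℝ, dmpaShrink r p q δ x = u ∧ dmpaAin r p q δ x = dmpaT p q δ * u ∧
      dmpaAout r p q δ x = dmpaT p q δ * u ∧ dmpaAbin r p q δ x = dmpaT p q δ * (1 - u) ∧
      dmpaAbout r p q δ x = dmpaT p q δ * (1 - u) := by
    intro x
    have hA : dmpaAin r p q δ x = dmpaT p q δ * dmpaShrink r p q δ x := by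
      rw [dmpaShrink, mul_div_cancel₀ _ hT]
    refine ⟨_, rfl, hA, hA, ?_, ?_⟩ <;> rw [mul_sub, ← hA] <;>
      simp only [dmpaAbin, dmpaAbout, dmpaAin, dmpaT] <;> ring
  obtain ⟨u, hu, hu₁, -, hu₂, -⟩ := key a
  obtain ⟨v, hv, -, hv₁, -, hv₂⟩ := key b
  have linear : ∀ c d e : ℝ, dmpaT p q δ * c / (dmpaT p q δ - dmpaT p q δ * d - dmpaT p q δ * e) =
      c / (1 - d - e) := by
    intro c d e
    rw [← mul_div_mul_left c (1 - d - e) hT]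
    ring_nf
  have quadratic : ∀ c d e f g : ℝ, dmpaT p q δ ^ 2 * c / (dmpaT p q δ ^ 2 - dmpaT p q δ ^ 2 * d -
      dmpaT p q δ ^ 2 * e - dmpaT p q δ ^ 2 * f - dmpaT p q δ ^ 2 * g) =
      c / (1 - d - e - f - g) := by
    intro c d e f g
    rw [← mul_div_mul_left c (1 - d - e - f - g) (pow_ne_zero 2 hT)]
    ring_nf
  have square : ∀ x y z : ℝ, dmpaT p q δ * x * (dmpaT p q δ * y) * z =
      dmpaT p q δ ^ 2 * (x * y * z) := fun x y z => by ring
  simp only [dmpaF, Prod.map_apply, hu, hv, dmpaP1RR, dmpaP1BR, dmpaP2RR, dmpaP2BR, dmpaP3RR,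
    dmpaP3BR, dmpaP3RB, dmpaDen1RR, dmpaDen1BR, dmpaDen2RR, dmpaDen2BR, dmpaD3, hu₁, hu₂, hv₁, hv₂,
    square, quadratic]
  simp only [mul_assoc (dmpaT p q δ), linear]
  simp [dmpaAin, dmpaAout, dmpaAbin, dmpaAbout, dmpaT, dmpaS]

theorem dmpaT_pos {p q δ : ℝ} (hpq : 0 ≤ p + q) (hδ : 0 ≤ δ) : 0 < dmpaT p q δ :=
  add_pos_of_pos_of_nonneg one_pos (mul_nonneg hpq hδ)

theorem dmpaShrink_mem_Icc {r p q δ x : ℝ} (hr : r ∈ Icc (0 : ℝ) 1) (hpq : 0 ≤ p + q)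
    (hδ : 0 ≤ δ) (hx : x ∈ Icc (0 : ℝ) 1) : dmpaShrink r p q δ x ∈ Icc (0 : ℝ) 1 := by
  have hT := dmpaT_pos hpq hδ
  have hs : 0 ≤ dmpaS p q δ := mul_nonneg hpq hδ
  refine ⟨div_nonneg (add_nonneg hx.1 (mul_nonneg hr.1 hs)) hT.le, (div_le_one hT).2 ?_⟩
  exact add_le_add hx.2 (mul_le_of_le_one_left hs hr.2)

theorem dist_dmpaShrink {r p q δ : ℝ} (hT : 0 < dmpaT p q δ) (x y : ℝ) :
    dist (dmpaShrink r p q δ x) (dmpaShrink r p q δ y) = dist x y / dmpaT p q δ := by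
  rw [dmpaShrink, dmpaShrink, Real.dist_eq, ← sub_div, abs_div, abs_of_pos hT, Real.dist_eq]
  simp [dmpaAin]

theorem dist_map_dmpaShrink {r p q δ : ℝ} (hT : 0 < dmpaT p q δ) (θ θ' : ℝ × ℝ) :
    dist (Prod.map (dmpaShrink r p q δ) (dmpaShrink r p q δ) θ)
      (Prod.map (dmpaShrink r p q δ) (dmpaShrink r p q δ) θ') = dist θ θ' / dmpaT p q δ := by
  rw [Prod.dist_eq, Prod.dist_eq, ← max_div_div_right hT.le]
  simp [dist_dmpaShrink hT]

theorem convexCombo_pos {x a b : ℝ} (hx : x ∈ Icc (0 : ℝ) 1) (ha : 0 < a) (hb : 0 < b) :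
    0 < (1 - x) * a + x * b := by
  rcases hx.1.eq_or_lt with rfl | h
  · simpa using ha
  · exact add_pos_of_nonneg_of_pos (mul_nonneg (sub_nonneg.2 hx.2) ha.le) (mul_pos h hb)

theorem dmpaDen_zero_pos {r p q hR hB x y : ℝ} (hhR : hR ∈ Ioo (0 : ℝ) 1)
    (hhB : hB ∈ Ioo (0 : ℝ) 1) (hx : x ∈ Icc (0 : ℝ) 1) (hy : y ∈ Icc (0 : ℝ) 1) :
    0 < dmpaDen1RR r p q hR hB 0 x ∧ 0 < dmpaDen1BR r p q hR hB 0 x ∧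
      0 < dmpaDen2RR r p q hR 0 y ∧ 0 < dmpaDen2BR r p q hB 0 y ∧
      0 < dmpaD3 r p q hR hB 0 x y := by
  obtain ⟨hR0, hR1⟩ := hhR
  obtain ⟨hB0, hB1⟩ := hhB
  have hR' := sub_pos.2 hR1
  have hB' := sub_pos.2 hB1
  refine ⟨(convexCombo_pos hx hB' hR0).trans_eq ?_, (convexCombo_pos hx hB0 hR').trans_eq ?_,
    (convexCombo_pos hy hR' hR0).trans_eq ?_, (convexCombo_pos hy hB0 hB').trans_eq ?_,
    (convexCombo_pos hy (convexCombo_pos hx hB0 hR') (convexCombo_pos hx hB' hR0)).trans_eq ?_⟩ <;>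
  · simp only [dmpaDen1RR, dmpaDen1BR, dmpaDen2RR, dmpaDen2BR, dmpaD3, dmpaAin, dmpaAout, dmpaAbin,
      dmpaAbout, dmpaT, dmpaS]
    ring

theorem exists_lipschitzOnWith_dmpaF_zero {r p q hR hB : ℝ} (hhR : hR ∈ Ioo (0 : ℝ) 1)
    (hhB : hB ∈ Ioo (0 : ℝ) 1) :
    ∃ K, LipschitzOnWith K (dmpaF r p q hR hB 0) (Icc (0 : ℝ) 1 ×ˢ Icc (0 : ℝ) 1) := by
  refine ContDiffOn.exists_lipschitzOnWith (n := 1) ?_ one_ne_zero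
    ((convex_Icc 0 1).prod (convex_Icc 0 1)) (isCompact_Icc.prod isCompact_Icc)
  have hden := fun (θ : ℝ × ℝ) (hθ : θ ∈ Icc (0 : ℝ) 1 ×ˢ Icc (0 : ℝ) 1) =>
    dmpaDen_zero_pos (r := r) (p := p) (q := q) hhR hhB hθ.1 hθ.2
  have h₁ := fun θ hθ => (hden θ hθ).1.ne'
  have h₂ := fun θ hθ => (hden θ hθ).2.1.ne'
  have h₃ := fun θ hθ => (hden θ hθ).2.2.1.ne'
  have h₄ := fun θ hθ => (hden θ hθ).2.2.2.1.ne'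
  have h₅ := fun θ hθ => (hden θ hθ).2.2.2.2.ne'
  simp only [dmpaDen1RR, dmpaDen1BR, dmpaDen2RR, dmpaDen2BR, dmpaD3, dmpaAin, dmpaAout,
    dmpaAbin, dmpaAbout] at h₁ h₂ h₃ h₄ h₅
  unfold dmpaF
  simp only [dmpaP1RR, dmpaP1BR, dmpaP2RR, dmpaP2BR, dmpaP3RR, dmpaP3BR, dmpaP3RB, dmpaDen1RR,
    dmpaDen1BR, dmpaDen2RR, dmpaDen2BR, dmpaD3, dmpaAin, dmpaAout, dmpaAbin, dmpaAbout]
  fun_prop (disch := assumption)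

theorem dmpaF_zero_mapsTo {r p q hR hB : ℝ} (hr : r ∈ Icc (0 : ℝ) 1) (hp : 0 ≤ p) (hq : 0 ≤ q)
    (hpq : p + q ≤ 1) (hhR : hR ∈ Ioo (0 : ℝ) 1) (hhB : hB ∈ Ioo (0 : ℝ) 1) :
    MapsTo (dmpaF r p q hR hB 0) (Icc (0 : ℝ) 1 ×ˢ Icc (0 : ℝ) 1)
      (Icc (0 : ℝ) 1 ×ˢ Icc (0 : ℝ) 1) := by
  rintro ⟨x, y⟩ ⟨hx, hy⟩
  obtain ⟨h₁, h₂, h₃, h₄, h₅⟩ := dmpaDen_zero_pos (r := r) (p := p) (q := q) hhR hhB hx hy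
  obtain ⟨hR0, hR1⟩ := hhR
  obtain ⟨hB0, hB1⟩ := hhB
  have hR' := (sub_pos.2 hR1).le
  have hB' := (sub_pos.2 hB1).le
  have hx0 : 0 ≤ x := hx.1
  have hy0 : 0 ≤ y := hy.1
  have hx' : 0 ≤ 1 - x := sub_nonneg.2 hx.2
  have hy' : 0 ≤ 1 - y := sub_nonneg.2 hy.2
  have div_mem : ∀ {a b c : ℝ}, 0 < b → 0 ≤ a → 0 ≤ c → b - a = c → a / b ∈ Icc (0 : ℝ) 1 :=
    fun hb ha hc h => ⟨div_nonneg ha hb.le, (div_le_one hb).2 (by linarith)⟩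
  have mix : ∀ {u v t : ℝ}, u ∈ Icc (0 : ℝ) 1 → v ∈ Icc (0 : ℝ) 1 → t ∈ Icc (0 : ℝ) 1 →
      t * u + (1 - t) * v ∈ Icc (0 : ℝ) 1 := fun hu hv ht =>
    convex_Icc 0 1 hu hv ht.1 (sub_nonneg.2 ht.2) (by ring)
  have mix₃ : ∀ {a b u v w : ℝ}, 0 ≤ a → 0 ≤ b → a + b ≤ 1 → u ∈ Icc (0 : ℝ) 1 →
      v ∈ Icc (0 : ℝ) 1 → w ∈ Icc (0 : ℝ) 1 →
      a * u + b * v + (1 - a - b) * w ∈ Icc (0 : ℝ) 1 := by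
    intro a b u v w ha hb hab hu hv hw
    have hc : 0 ≤ 1 - a - b := by linarith
    refine ⟨add_nonneg (add_nonneg (mul_nonneg ha hu.1) (mul_nonneg hb hv.1))
      (mul_nonneg hc hw.1), ?_⟩
    linarith [mul_le_of_le_one_right ha hu.2, mul_le_of_le_one_right hb hv.2,
      mul_le_of_le_one_right hc hw.2]
  have hA : dmpaAin r p q 0 x = x ∧ dmpaAout r p q 0 y = y ∧ dmpaAbin r p q 0 x = 1 - x ∧
      dmpaAbout r p q 0 y = 1 - y := by
    simp [dmpaAin, dmpaAout, dmpaAbin, dmpaAbout, dmpaS]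
  have hT : dmpaT p q 0 = 1 := by simp [dmpaT, dmpaS]
  obtain ⟨hA₁, hA₂, hA₃, hA₄⟩ := hA
  constructor
  · refine mix₃ hp hq hpq (mix (div_mem (c := (1 - x) * (1 - hB)) h₁ ?_ ?_ ?_)
      (div_mem (c := (1 - x) * hB) h₂ ?_ ?_ ?_) hr) hr ?_
    on_goal 7 =>
      rw [dmpaP3RR, dmpaP3BR, ← add_div]
      refine div_mem (c := y * (1 - x) * (1 - hB) + (1 - y) * (1 - x) * hB) h₅ ?_ ?_ ?_
    all_goals
      try simp only [dmpaDen1RR, dmpaDen1BR, dmpaD3, hA₁, hA₂, hA₃, hA₄, hT]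
      first | positivity | ring
  · refine mix₃ hp hq hpq hr (mix (div_mem (c := (1 - y) * (1 - hR)) h₃ ?_ ?_ ?_)
      (div_mem (c := (1 - y) * hB) h₄ ?_ ?_ ?_) hr) ?_
    on_goal 7 =>
      rw [dmpaP3RR, dmpaP3RB, ← add_div]
      refine div_mem (c := (1 - y) * x * (1 - hR) + (1 - y) * (1 - x) * hB) h₅ ?_ ?_ ?_
    all_goals
      try simp only [dmpaDen2RR, dmpaDen2BR, dmpaD3, hA₁, hA₂, hA₃, hA₄, hT]
      first | positivity | ring

theorem dist_le_euclidDist (a b : ℝ × ℝ) : dist a b ≤ euclidDist a b :=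
  max_le (Real.abs_le_sqrt (le_add_of_nonneg_right (sq_nonneg _)))
    (Real.abs_le_sqrt (le_add_of_nonneg_left (sq_nonneg _)))

theorem euclidDist_le_two_mul_dist (a b : ℝ × ℝ) : euclidDist a b ≤ 2 * dist a b := by
  have h₁ : (a.1 - b.1) ^ 2 ≤ dist a b ^ 2 := sq_le_sq' (neg_le_of_abs_le (le_max_left _ _))
    (le_of_abs_le (le_max_left _ _))
  have h₂ : (a.2 - b.2) ^ 2 ≤ dist a b ^ 2 := sq_le_sq' (neg_le_of_abs_le (le_max_right _ _))
    (le_of_abs_le (le_max_right _ _))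
  refine (Real.sqrt_le_left (by positivity)).2 ?_
  nlinarith [sq_nonneg (dist a b)]

/-- Banach's fixed point theorem on a complete invariant subset of a metric space. -/
theorem exists_unique_fixedPoint_tendsto_iterate {α : Type*} [MetricSpace α] {s : Set α}
    (hs : IsComplete s) (hne : s.Nonempty) {f : α → α} (hf : MapsTo f s s) {K : NNReal}
    (hK : K < 1) (hL : LipschitzOnWith K f s) :
    ∃ y ∈ s, f y = y ∧ (∀ z ∈ s, f z = z → z = y) ∧
      ∀ x ∈ s, Tendsto (fun k => f^[k] x) atTop (nhds y) := by
  have hc : ContractingWith K (hf.restrict f s s) := ⟨hK, hL.mapsToRestrict hf⟩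
  have hfix := fun x (hx : x ∈ s) => hc.exists_fixedPoint' hs hf hx (edist_ne_top x (f x))
  have huniq : ∀ y ∈ s, f y = y → ∀ z ∈ s, f z = z → z = y := by
    intro y hy hfy z hz hfz
    have h₁ : hf.restrict f s s ⟨y, hy⟩ = ⟨y, hy⟩ := Subtype.ext hfy
    have h₂ : hf.restrict f s s ⟨z, hz⟩ = ⟨z, hz⟩ := Subtype.ext hfz
    exact congrArg Subtype.val (hc.fixedPoint_unique' h₂ h₁)
  obtain ⟨x₀, hx₀⟩ := hne
  obtain ⟨y, hy, hfy, -⟩ := hfix x₀ hx₀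
  refine ⟨y, hy, hfy, huniq y hy hfy, fun x hx => ?_⟩
  obtain ⟨z, hz, hfz, hlim, -⟩ := hfix x hx
  rwa [← huniq y hy hfy z hz hfz]

/-- For `r ∈ (0,1)`, `p, q ≥ 0` with `p + q ≤ 1`, `p + q > 0`, and
`h_R, h_B ∈ (0,1)`, there exists `δ* > 0` such that for every `δ > δ*` the DMPA limit map `F`
maps `[0,1]²` into itself and is a contraction on `[0,1]²` in the Euclidean norm (with some
constant `L < 1`); consequently `F` has a unique fixed point `θ* ∈ [0,1]²`, and for every
`θ₀ ∈ [0,1]²` the iterates `θ_{k+1} = F(θ_k)` converge to `θ*`. -/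
theorem dmpa_contraction_unique_fixed_point_and_iterates_converge
    (r p q hR hB : ℝ)
    (hr : r ∈ Ioo (0 : ℝ) 1) (hp : 0 ≤ p) (hq : 0 ≤ q)
    (hpq : p + q ≤ 1) (hpq0 : 0 < p + q)
    (hhR : hR ∈ Ioo (0 : ℝ) 1) (hhB : hB ∈ Ioo (0 : ℝ) 1) :
    ∃ δstar > (0 : ℝ), ∀ δ > δstar,
      Set.MapsTo (dmpaF r p q hR hB δ) (Icc (0 : ℝ) 1 ×ˢ Icc (0 : ℝ) 1)
        (Icc (0 : ℝ) 1 ×ˢ Icc (0 : ℝ) 1) ∧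
      (∃ L : ℝ, 0 ≤ L ∧ L < 1 ∧
        ∀ θ ∈ Icc (0 : ℝ) 1 ×ˢ Icc (0 : ℝ) 1, ∀ θ' ∈ Icc (0 : ℝ) 1 ×ˢ Icc (0 : ℝ) 1,
          euclidDist (dmpaF r p q hR hB δ θ) (dmpaF r p q hR hB δ θ') ≤
            L * euclidDist θ θ') ∧
      ∃ θstar ∈ Icc (0 : ℝ) 1 ×ˢ Icc (0 : ℝ) 1,
        dmpaF r p q hR hB δ θstar = θstar ∧
        (∀ θ' ∈ Icc (0 : ℝ) 1 ×ˢ Icc (0 : ℝ) 1, dmpaF r p q hR hB δ θ' = θ' → θ' = θstar) ∧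
        ∀ θ₀ ∈ Icc (0 : ℝ) 1 ×ˢ Icc (0 : ℝ) 1,
          Tendsto (fun k => (dmpaF r p q hR hB δ)^[k] θ₀) atTop (nhds θstar) := by
  have hr' : r ∈ Icc (0 : ℝ) 1 := ⟨hr.1.le, hr.2.le⟩
  obtain ⟨K, hK⟩ := exists_lipschitzOnWith_dmpaF_zero (r := r) (p := p) (q := q) hhR hhB
  refine ⟨(2 * K + 1) / (p + q), by positivity, fun δ hδ => ?_⟩
  have hδ0 : 0 < δ := lt_trans (by positivity) hδ
  have hT := dmpaT_pos hpq0.le hδ0.le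
  have hKT : 2 * (K : ℝ) < dmpaT p q δ := by
    have := (div_lt_iff₀' hpq0).1 hδ
    unfold dmpaT dmpaS
    linarith
  have hshrink : MapsTo (Prod.map (dmpaShrink r p q δ) (dmpaShrink r p q δ))
      (Icc (0 : ℝ) 1 ×ˢ Icc (0 : ℝ) 1) (Icc (0 : ℝ) 1 ×ˢ Icc (0 : ℝ) 1) := fun θ hθ =>
    ⟨dmpaShrink_mem_Icc hr' hpq0.le hδ0.le hθ.1, dmpaShrink_mem_Icc hr' hpq0.le hδ0.le hθ.2⟩
  have hF : dmpaF r p q hR hB δ = dmpaF r p q hR hB 0 ∘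
      Prod.map (dmpaShrink r p q δ) (dmpaShrink r p q δ) :=
    funext (dmpaF_eq_dmpaF_zero_shrink hT.ne')
  have hmaps : MapsTo (dmpaF r p q hR hB δ) (Icc (0 : ℝ) 1 ×ˢ Icc (0 : ℝ) 1)
      (Icc (0 : ℝ) 1 ×ˢ Icc (0 : ℝ) 1) :=
    hF ▸ (dmpaF_zero_mapsTo hr' hp hq hpq hhR hhB).comp hshrink
  have hdist : ∀ θ ∈ Icc (0 : ℝ) 1 ×ˢ Icc (0 : ℝ) 1, ∀ θ' ∈ Icc (0 : ℝ) 1 ×ˢ Icc (0 : ℝ) 1,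
      dist (dmpaF r p q hR hB δ θ) (dmpaF r p q hR hB δ θ') ≤ K / dmpaT p q δ * dist θ θ' := by
    intro θ hθ θ' hθ'
    have h := hK.dist_le_mul _ (hshrink hθ) _ (hshrink hθ')
    rw [dist_map_dmpaShrink hT] at h
    rw [hF, div_mul_eq_mul_div, ← mul_div_assoc']
    exact h
  have hlt : (K : ℝ) / dmpaT p q δ < 1 := (div_lt_one hT).2 (by linarith [K.coe_nonneg])
  refine ⟨hmaps, ⟨2 * K / dmpaT p q δ, by positivity, (div_lt_one hT).2 hKT, ?_⟩, ?_⟩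
  · intro θ hθ θ' hθ'
    calc euclidDist (dmpaF r p q hR hB δ θ) (dmpaF r p q hR hB δ θ')
        ≤ 2 * (K / dmpaT p q δ * dist θ θ') :=
          (euclidDist_le_two_mul_dist _ _).trans (by gcongr; exact hdist θ hθ θ' hθ')
      _ = 2 * K / dmpaT p q δ * dist θ θ' := by ring
      _ ≤ 2 * K / dmpaT p q δ * euclidDist θ θ' := by
          gcongr
          exact dist_le_euclidDist θ θ'
  · exact exists_unique_fixedPoint_tendsto_iterate
      (isCompact_Icc.prod isCompact_Icc).isComplete ⟨(0, 0), by simp⟩ hmaps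
      (K := ⟨K / dmpaT p q δ, by positivity⟩) hlt
      (LipschitzOnWith.of_dist_le_mul hdist)
end
end

section
/- Let r ∈ (0,1), p ≥ 0, q ≥ 0 with p + q ≤ 1 and p + q > 0, and homophily parameters h_R, h_B ∈ (0,1). For δ large enough that all denominators in the definition of the DMPA limit map F are strictly positive on [0,1]², F is continuously differentiable on [0,1]², and each of the four partial derivatives ∂F_i/∂θ_j (i ∈ {1,2}, j ∈ {in, out}) tends to 0 as δ → ∞, uniformly over θ ∈ [0,1]². In particular, there exists δ* > 0 such that for all δ > δ*, the Frobenius norm of the Jacobian of F, namely (Σ_{i,j} |∂F_i/∂θ_j (θ)|²)^{1/2}, is strictly less than 1 for every θ ∈ [0,1]². -/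
open Set Filter

noncomputable section

/-- `f` is differentiable at `x` with derivative bounded by `K` in absolute value. -/
def HasDerivBoundAt (K : ℝ) (f : ℝ → ℝ) (x : ℝ) : Prop :=
  ∃ d, HasDerivAt f d x ∧ |d| ≤ K

lemma HasDerivBoundAt.abs_deriv_le {K x : ℝ} {f : ℝ → ℝ} (hf : HasDerivBoundAt K f x) :
    |deriv f x| ≤ K := by
  obtain ⟨d, hd, hK⟩ := hf
  rwa [hd.deriv]

lemma hasDerivBoundAt_const {K : ℝ} (hK : 0 ≤ K) (a x : ℝ) :
    HasDerivBoundAt K (fun _ => a) x :=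
  ⟨0, hasDerivAt_const x a, by simpa using hK⟩

/-- The shape shared by both coordinates of the limit map. -/
lemma HasDerivBoundAt.mixture {K x r u w a : ℝ} {f₁ f₂ f₃ f₄ : ℝ → ℝ}
    (hr0 : 0 ≤ r) (hr1 : r ≤ 1) (hu : 0 ≤ u) (hw : 0 ≤ w) (huw : u + w ≤ 1) (hK : 0 ≤ K)
    (h₁ : HasDerivBoundAt K f₁ x) (h₂ : HasDerivBoundAt K f₂ x)
    (h₃ : HasDerivBoundAt K f₃ x) (h₄ : HasDerivBoundAt K f₄ x) :
    HasDerivBoundAt (2 * K)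
      (fun y => a + u * (r * f₁ y + (1 - r) * f₂ y) + w * (f₃ y + f₄ y)) x := by
  obtain ⟨d₁, hd₁, hb₁⟩ := h₁
  obtain ⟨d₂, hd₂, hb₂⟩ := h₂
  obtain ⟨d₃, hd₃, hb₃⟩ := h₃
  obtain ⟨d₄, hd₄, hb₄⟩ := h₄
  refine ⟨u * (r * d₁ + (1 - r) * d₂) + w * (d₃ + d₄),
    ((((hd₁.const_mul r).add (hd₂.const_mul (1 - r))).const_mul u).const_add a).add
      ((hd₃.add hd₄).const_mul w), ?_⟩
  have hr1' : 0 ≤ 1 - r := by linarith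
  have h12 : |r * d₁ + (1 - r) * d₂| ≤ K := by
    calc |r * d₁ + (1 - r) * d₂| ≤ |r * d₁| + |(1 - r) * d₂| := abs_add_le _ _
      _ = r * |d₁| + (1 - r) * |d₂| := by
        rw [abs_mul, abs_mul, abs_of_nonneg hr0, abs_of_nonneg hr1']
      _ ≤ r * K + (1 - r) * K := by gcongr
      _ = K := by ring
  have h34 : |d₃ + d₄| ≤ 2 * K := (abs_add_le _ _).trans (by linarith)
  calc |u * (r * d₁ + (1 - r) * d₂) + w * (d₃ + d₄)|
      ≤ |u * (r * d₁ + (1 - r) * d₂)| + |w * (d₃ + d₄)| := abs_add_le _ _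
    _ = u * |r * d₁ + (1 - r) * d₂| + w * |d₃ + d₄| := by
      rw [abs_mul, abs_mul, abs_of_nonneg hu, abs_of_nonneg hw]
    _ ≤ u * K + w * (2 * K) := by gcongr
    _ ≤ 2 * K := by nlinarith

/-- A quotient of two linear interpolations on `[0, T]`, with nonnegative numerator weights at
most `M` and denominator weights between `c * M` and `M`, has derivative `O(1 / T)`. -/
lemma hasDerivBoundAt_interpolation_div {f : ℝ → ℝ} {T M c a₀ a₁ b₀ b₁ k x : ℝ}
    (hT : 0 < T) (hM : 0 < M) (hc : 0 < c) (hx0 : 0 ≤ x + k) (hxT : x + k ≤ T)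
    (ha₀ : 0 ≤ a₀) (ha₀M : a₀ ≤ M) (ha₁ : 0 ≤ a₁) (ha₁M : a₁ ≤ M)
    (hb₀ : c * M ≤ b₀) (hb₀M : b₀ ≤ M) (hb₁ : c * M ≤ b₁) (hb₁M : b₁ ≤ M)
    (hf : ∀ y, f y = ((T - (y + k)) * a₀ + (y + k) * a₁) /
      ((T - (y + k)) * b₀ + (y + k) * b₁)) :
    HasDerivBoundAt (2 / (c ^ 2 * T)) f x := by
  have haff (w₀ w₁ : ℝ) :
      HasDerivAt (fun y => (T - (y + k)) * w₀ + (y + k) * w₁) (w₁ - w₀) x := by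
    have hid := (hasDerivAt_id x).add_const k
    exact (((hid.const_sub T).mul_const w₀).add (hid.mul_const w₁)).congr_deriv (by ring)
  have hxT' : 0 ≤ T - (x + k) := by linarith
  have hnum0 : 0 ≤ (T - (x + k)) * a₀ + (x + k) * a₁ := by positivity
  have hnum : (T - (x + k)) * a₀ + (x + k) * a₁ ≤ M * T := by
    calc _ ≤ (T - (x + k)) * M + (x + k) * M := by gcongr
      _ = M * T := by ring
  have hden : (T - (x + k)) * b₀ + (x + k) * b₁ ≤ M * T := by
    calc _ ≤ (T - (x + k)) * M + (x + k) * M := by gcongr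
      _ = M * T := by ring
  have hden_ge : c * M * T ≤ (T - (x + k)) * b₀ + (x + k) * b₁ := by
    calc c * M * T = (T - (x + k)) * (c * M) + (x + k) * (c * M) := by ring
      _ ≤ _ := by gcongr
  have hcM : 0 < c * M := by positivity
  have hden0 : 0 < (T - (x + k)) * b₀ + (x + k) * b₁ :=
    (by positivity : 0 < c * M * T).trans_le hden_ge
  rw [funext hf]
  refine ⟨_, (haff a₀ a₁).div (haff b₀ b₁) hden0.ne', ?_⟩
  have hda : |a₁ - a₀| ≤ M := abs_le.2 ⟨by linarith, by linarith⟩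
  have hdb : |b₁ - b₀| ≤ M := abs_le.2 ⟨by linarith, by linarith⟩
  generalize (T - (x + k)) * a₀ + (x + k) * a₁ = n at *
  generalize (T - (x + k)) * b₀ + (x + k) * b₁ = d at *
  have htop : |(a₁ - a₀) * d - n * (b₁ - b₀)| ≤ 2 * M ^ 2 * T := by
    calc _ ≤ |(a₁ - a₀) * d| + |n * (b₁ - b₀)| := abs_sub _ _
      _ = |a₁ - a₀| * d + n * |b₁ - b₀| := by
        rw [abs_mul, abs_mul, abs_of_pos hden0, abs_of_nonneg hnum0]
      _ ≤ M * (M * T) + (M * T) * M := by gcongr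
      _ = 2 * M ^ 2 * T := by ring
  rw [abs_div, abs_of_pos (pow_pos hden0 2)]
  calc _ ≤ 2 * M ^ 2 * T / (c * M * T) ^ 2 := by gcongr
    _ = 2 / (c ^ 2 * T) := by field_simp

section DenominatorIdentities

variable (r p q hR hB δ θin θout : ℝ)

lemma dmpaAbin_eq : dmpaAbin r p q δ θin = dmpaT p q δ - dmpaAin r p q δ θin := by
  simp only [dmpaAbin, dmpaT, dmpaAin]; ring

lemma dmpaAbout_eq : dmpaAbout r p q δ θout = dmpaT p q δ - dmpaAout r p q δ θout := by
  simp only [dmpaAbout, dmpaT, dmpaAout]; ring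

lemma dmpaDen1RR_eq : dmpaDen1RR r p q hR hB δ θin =
    dmpaAbin r p q δ θin * (1 - hB) + dmpaAin r p q δ θin * hR := by
  simp only [dmpaDen1RR, dmpaAbin_eq]; ring

lemma dmpaDen1BR_eq : dmpaDen1BR r p q hR hB δ θin =
    dmpaAbin r p q δ θin * hB + dmpaAin r p q δ θin * (1 - hR) := by
  simp only [dmpaDen1BR, dmpaAbin_eq]; ring

lemma dmpaDen2RR_eq : dmpaDen2RR r p q hR δ θout =
    dmpaAbout r p q δ θout * (1 - hR) + dmpaAout r p q δ θout * hR := by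
  simp only [dmpaDen2RR, dmpaAbout_eq]; ring

lemma dmpaDen2BR_eq : dmpaDen2BR r p q hB δ θout =
    dmpaAbout r p q δ θout * hB + dmpaAout r p q δ θout * (1 - hB) := by
  simp only [dmpaDen2BR, dmpaAbout_eq]; ring

lemma dmpaD3_eq : dmpaD3 r p q hR hB δ θin θout =
    dmpaAbout r p q δ θout * dmpaAbin r p q δ θin * hB
      + dmpaAbout r p q δ θout * dmpaAin r p q δ θin * (1 - hR)
      + dmpaAout r p q δ θout * dmpaAbin r p q δ θin * (1 - hB)
      + dmpaAout r p q δ θout * dmpaAin r p q δ θin * hR := by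
  simp only [dmpaD3, dmpaAbin_eq, dmpaAbout_eq]; ring

end DenominatorIdentities

section Estimates

variable {r p q hR hB δ c θin θout : ℝ}

lemma dmpaAin_pos (hr : r ∈ Ioo (0 : ℝ) 1) (hpq0 : 0 < p + q) (hδ : 0 < δ)
    (hin : θin ∈ Icc (0 : ℝ) 1) : 0 < dmpaAin r p q δ θin :=
  add_pos_of_nonneg_of_pos hin.1 (mul_pos hr.1 (mul_pos hpq0 hδ))

lemma dmpaAbin_pos (hr : r ∈ Ioo (0 : ℝ) 1) (hpq0 : 0 < p + q) (hδ : 0 < δ)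
    (hin : θin ∈ Icc (0 : ℝ) 1) : 0 < dmpaAbin r p q δ θin :=
  add_pos_of_nonneg_of_pos (sub_nonneg.2 hin.2)
    (mul_pos (sub_pos.2 hr.2) (mul_pos hpq0 hδ))

lemma dmpaAout_pos (hr : r ∈ Ioo (0 : ℝ) 1) (hpq0 : 0 < p + q) (hδ : 0 < δ)
    (hout : θout ∈ Icc (0 : ℝ) 1) : 0 < dmpaAout r p q δ θout :=
  dmpaAin_pos hr hpq0 hδ hout

lemma dmpaAbout_pos (hr : r ∈ Ioo (0 : ℝ) 1) (hpq0 : 0 < p + q) (hδ : 0 < δ)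
    (hout : θout ∈ Icc (0 : ℝ) 1) : 0 < dmpaAbout r p q δ θout :=
  dmpaAbin_pos hr hpq0 hδ hout

lemma dmpa_denominators_pos (hr : r ∈ Ioo (0 : ℝ) 1) (hpq0 : 0 < p + q)
    (hhR : hR ∈ Ioo (0 : ℝ) 1) (hhB : hB ∈ Ioo (0 : ℝ) 1) (hδ : 0 < δ)
    (hin : θin ∈ Icc (0 : ℝ) 1) (hout : θout ∈ Icc (0 : ℝ) 1) :
    0 < dmpaDen1RR r p q hR hB δ θin ∧
    0 < dmpaDen1BR r p q hR hB δ θin ∧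
    0 < dmpaDen2RR r p q hR δ θout ∧
    0 < dmpaDen2BR r p q hB δ θout ∧
    0 < dmpaD3 r p q hR hB δ θin θout := by
  have hA := dmpaAin_pos hr hpq0 hδ hin
  have hA' := dmpaAbin_pos hr hpq0 hδ hin
  have hC := dmpaAout_pos hr hpq0 hδ hout
  have hC' := dmpaAbout_pos hr hpq0 hδ hout
  have hR0 := hhR.1
  have hB0 := hhB.1
  have hR1 : 0 < 1 - hR := sub_pos.2 hhR.2
  have hB1 : 0 < 1 - hB := sub_pos.2 hhB.2
  rw [dmpaDen1RR_eq, dmpaDen1BR_eq, dmpaDen2RR_eq, dmpaDen2BR_eq, dmpaD3_eq]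
  refine ⟨?_, ?_, ?_, ?_, ?_⟩ <;> positivity

lemma contDiffOn_dmpaF (hr : r ∈ Ioo (0 : ℝ) 1) (hpq0 : 0 < p + q)
    (hhR : hR ∈ Ioo (0 : ℝ) 1) (hhB : hB ∈ Ioo (0 : ℝ) 1) (hδ : 0 < δ) :
    ContDiffOn ℝ 1 (dmpaF r p q hR hB δ) (Icc (0 : ℝ) 1 ×ˢ Icc (0 : ℝ) 1) := by
  have hpos (θ : ℝ × ℝ) (hθ : θ ∈ Icc (0 : ℝ) 1 ×ˢ Icc (0 : ℝ) 1) :=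
    dmpa_denominators_pos hr hpq0 hhR hhB hδ hθ.1 hθ.2
  have h₁ (θ : ℝ × ℝ) (hθ : θ ∈ Icc (0 : ℝ) 1 ×ˢ Icc (0 : ℝ) 1) := (hpos θ hθ).1.ne'
  have h₂ (θ : ℝ × ℝ) (hθ : θ ∈ Icc (0 : ℝ) 1 ×ˢ Icc (0 : ℝ) 1) := (hpos θ hθ).2.1.ne'
  have h₃ (θ : ℝ × ℝ) (hθ : θ ∈ Icc (0 : ℝ) 1 ×ˢ Icc (0 : ℝ) 1) := (hpos θ hθ).2.2.1.ne'
  have h₄ (θ : ℝ × ℝ) (hθ : θ ∈ Icc (0 : ℝ) 1 ×ˢ Icc (0 : ℝ) 1) := (hpos θ hθ).2.2.2.1.ne'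
  have h₅ (θ : ℝ × ℝ) (hθ : θ ∈ Icc (0 : ℝ) 1 ×ˢ Icc (0 : ℝ) 1) := (hpos θ hθ).2.2.2.2.ne'
  simp only [dmpaDen1RR, dmpaDen1BR, dmpaDen2RR, dmpaDen2BR, dmpaD3, dmpaAin, dmpaAbin,
    dmpaAout, dmpaAbout] at h₁ h₂ h₃ h₄ h₅
  unfold dmpaF dmpaP1RR dmpaP1BR dmpaP2RR dmpaP2BR dmpaP3RR dmpaP3BR dmpaP3RB
    dmpaDen1RR dmpaDen1BR dmpaDen2RR dmpaDen2BR dmpaD3 dmpaAin dmpaAbin dmpaAout dmpaAbout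
  fun_prop (disch := assumption)

/-- Every partial derivative of `dmpaF` is `O(1 / T)` when the homophily parameters stay at
distance at least `c` from `0` and `1`. -/
lemma dmpaF_partialDerivs_bound (hr : r ∈ Ioo (0 : ℝ) 1) (hp : 0 ≤ p) (hq : 0 ≤ q)
    (hpq : p + q ≤ 1) (hpq0 : 0 < p + q) (hδ : 0 < δ) (hc : 0 < c)
    (hR0 : c ≤ hR) (hR1 : c ≤ 1 - hR) (hB0 : c ≤ hB) (hB1 : c ≤ 1 - hB)
    (hin : θin ∈ Icc (0 : ℝ) 1) (hout : θout ∈ Icc (0 : ℝ) 1) :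
    HasDerivBoundAt (2 * (2 / (c ^ 2 * dmpaT p q δ)))
      (fun x => (dmpaF r p q hR hB δ (x, θout)).1) θin ∧
    HasDerivBoundAt (2 * (2 / (c ^ 2 * dmpaT p q δ)))
      (fun y => (dmpaF r p q hR hB δ (θin, y)).1) θout ∧
    HasDerivBoundAt (2 * (2 / (c ^ 2 * dmpaT p q δ)))
      (fun x => (dmpaF r p q hR hB δ (x, θout)).2) θin ∧
    HasDerivBoundAt (2 * (2 / (c ^ 2 * dmpaT p q δ)))
      (fun y => (dmpaF r p q hR hB δ (θin, y)).2) θout := by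
  have hA : 0 < θin + r * dmpaS p q δ := dmpaAin_pos hr hpq0 hδ hin
  have hA' := dmpaAbin_pos hr hpq0 hδ hin
  have hC : 0 < θout + r * dmpaS p q δ := dmpaAout_pos hr hpq0 hδ hout
  have hC' := dmpaAbout_pos hr hpq0 hδ hout
  rw [dmpaAbin_eq, dmpaAin, sub_pos] at hA'
  rw [dmpaAbout_eq, dmpaAout, sub_pos] at hC'
  have hT : 0 < dmpaT p q δ := hA.trans hA'
  have hK : 0 ≤ 2 / (c ^ 2 * dmpaT p q δ) := by positivity
  have hw : 0 ≤ 1 - p - q := by linarith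
  have hconst (a x : ℝ) := hasDerivBoundAt_const hK a x
  have hmix {x u a : ℝ} {f₁ f₂ f₃ f₄ : ℝ → ℝ} (hu : 0 ≤ u) (huw : u + (1 - p - q) ≤ 1) :=
    HasDerivBoundAt.mixture (x := x) (a := a) (f₁ := f₁) (f₂ := f₂) (f₃ := f₃) (f₄ := f₄)
      hr.1.le hr.2.le hu hw huw hK
  have hsingle {f : ℝ → ℝ} {h b₀ b₁ x : ℝ} (hx0 : 0 < x + r * dmpaS p q δ)
      (hxT : x + r * dmpaS p q δ < dmpaT p q δ) (h0 : c ≤ h) (h1 : c ≤ 1 - h)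
      (hb₀ : c ≤ b₀) (hb₀' : c ≤ 1 - b₀) (hb₁ : c ≤ b₁) (hb₁' : c ≤ 1 - b₁) :=
    hasDerivBoundAt_interpolation_div (f := f) (M := 1) (a₀ := 0) (a₁ := h) (b₀ := b₀)
      (b₁ := b₁) hT one_pos hc hx0.le hxT.le
      le_rfl zero_le_one (by linarith) (by linarith) (by linarith) (by linarith) (by linarith)
      (by linarith)
  -- The weights are themselves interpolations in the frozen variable `z`.
  have hweight {z b₀ b₁ : ℝ} (hz0 : 0 < z) (hzT : z < dmpaT p q δ) (hb₀ : c ≤ b₀)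
      (hb₀' : c ≤ 1 - b₀) (hb₁ : c ≤ b₁) (hb₁' : c ≤ 1 - b₁) :
      c * dmpaT p q δ ≤ (dmpaT p q δ - z) * b₀ + z * b₁ ∧
        (dmpaT p q δ - z) * b₀ + z * b₁ ≤ dmpaT p q δ := by
    constructor <;> nlinarith
  have hjoint {f : ℝ → ℝ} {a₀ a₁ b₀₀ b₀₁ b₁₀ b₁₁ x z : ℝ} (hx0 : 0 < x + r * dmpaS p q δ)
      (hxT : x + r * dmpaS p q δ < dmpaT p q δ) (hz0 : 0 < z) (hzT : z < dmpaT p q δ)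
      (ha₀ : 0 ≤ a₀ ∧ a₀ ≤ dmpaT p q δ) (ha₁ : 0 ≤ a₁ ∧ a₁ ≤ dmpaT p q δ)
      (h₀₀ : c ≤ b₀₀) (h₀₀' : c ≤ 1 - b₀₀) (h₀₁ : c ≤ b₀₁) (h₀₁' : c ≤ 1 - b₀₁)
      (h₁₀ : c ≤ b₁₀) (h₁₀' : c ≤ 1 - b₁₀) (h₁₁ : c ≤ b₁₁) (h₁₁' : c ≤ 1 - b₁₁) :=
    hasDerivBoundAt_interpolation_div (f := f) hT hT hc hx0.le hxT.le
      ha₀.1 ha₀.2 ha₁.1 ha₁.2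
      (hweight hz0 hzT h₀₀ h₀₀' h₀₁ h₀₁').1 (hweight hz0 hzT h₀₀ h₀₀' h₀₁ h₀₁').2
      (hweight hz0 hzT h₁₀ h₁₀' h₁₁ h₁₁').1 (hweight hz0 hzT h₁₀ h₁₀' h₁₁ h₁₁').2
  have hmul {z h : ℝ} (hz0 : 0 < z) (hzT : z < dmpaT p q δ) (h0 : c ≤ h) (h1 : c ≤ 1 - h) :
      0 ≤ z * h ∧ z * h ≤ dmpaT p q δ := by
    constructor <;> nlinarith
  have hzero : (0 : ℝ) ≤ 0 ∧ 0 ≤ dmpaT p q δ := ⟨le_rfl, hT.le⟩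
  have hR0' : c ≤ 1 - (1 - hR) := by linarith
  have hB0' : c ≤ 1 - (1 - hB) := by linarith
  have h1RR : HasDerivBoundAt (2 / (c ^ 2 * dmpaT p q δ)) (dmpaP1RR r p q hR hB δ) θin :=
    hsingle hA hA' hR0 hR1 hB1 hB0' hR0 hR1 fun y => by
      rw [dmpaP1RR, dmpaDen1RR_eq, dmpaAbin_eq, dmpaAin]; ring
  have h1BR : HasDerivBoundAt (2 / (c ^ 2 * dmpaT p q δ)) (dmpaP1BR r p q hR hB δ) θin :=
    hsingle hA hA' hR1 hR0' hB0 hB1 hR1 hR0' fun y => by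
      rw [dmpaP1BR, dmpaDen1BR_eq, dmpaAbin_eq, dmpaAin]; ring
  have h2RR : HasDerivBoundAt (2 / (c ^ 2 * dmpaT p q δ)) (dmpaP2RR r p q hR δ) θout :=
    hsingle hC hC' hR0 hR1 hR1 hR0' hR0 hR1 fun y => by
      rw [dmpaP2RR, dmpaDen2RR_eq, dmpaAbout_eq, dmpaAout]; ring
  have h2BR : HasDerivBoundAt (2 / (c ^ 2 * dmpaT p q δ)) (dmpaP2BR r p q hB δ) θout :=
    hsingle hC hC' hB1 hB0' hB0 hB1 hB1 hB0' fun y => by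
      rw [dmpaP2BR, dmpaDen2BR_eq, dmpaAbout_eq, dmpaAout]; ring
  have hAc : 0 < dmpaT p q δ - (θin + r * dmpaS p q δ) := sub_pos.2 hA'
  have hAc' : dmpaT p q δ - (θin + r * dmpaS p q δ) < dmpaT p q δ := by linarith
  have hCc : 0 < dmpaT p q δ - (θout + r * dmpaS p q δ) := sub_pos.2 hC'
  have hCc' : dmpaT p q δ - (θout + r * dmpaS p q δ) < dmpaT p q δ := by linarith
  have h3RRin : HasDerivBoundAt (2 / (c ^ 2 * dmpaT p q δ))
      (fun x => dmpaP3RR r p q hR hB δ x θout) θin :=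
    hjoint hA hA' hC hC' hzero (hmul hC hC' hR0 hR1) hB0 hB1 hB1 hB0' hR1 hR0' hR0 hR1
      fun y => by
        rw [dmpaP3RR, dmpaD3_eq, dmpaAbin_eq, dmpaAin, dmpaAbout_eq, dmpaAout]
        congr 1 <;> ring
  have h3BRin : HasDerivBoundAt (2 / (c ^ 2 * dmpaT p q δ))
      (fun x => dmpaP3BR r p q hR hB δ x θout) θin :=
    hjoint hA hA' hC hC' hzero (hmul hCc hCc' hR1 hR0') hB0 hB1 hB1 hB0' hR1 hR0' hR0 hR1
      fun y => by
        rw [dmpaP3BR, dmpaD3_eq, dmpaAbin_eq, dmpaAin, dmpaAbout_eq, dmpaAout]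
        congr 1 <;> ring
  have h3RBin : HasDerivBoundAt (2 / (c ^ 2 * dmpaT p q δ))
      (fun x => dmpaP3RB r p q hR hB δ x θout) θin :=
    hjoint hA hA' hC hC' (hmul hC hC' hB1 hB0') hzero hB0 hB1 hB1 hB0' hR1 hR0' hR0 hR1
      fun y => by
        rw [dmpaP3RB, dmpaD3_eq, dmpaAbin_eq, dmpaAin, dmpaAbout_eq, dmpaAout]
        congr 1 <;> ring
  have h3RRout : HasDerivBoundAt (2 / (c ^ 2 * dmpaT p q δ))
      (dmpaP3RR r p q hR hB δ θin) θout :=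
    hjoint hC hC' hA hA' hzero (hmul hA hA' hR0 hR1) hB0 hB1 hR1 hR0' hB1 hB0' hR0 hR1
      fun y => by
        rw [dmpaP3RR, dmpaD3_eq, dmpaAbin_eq, dmpaAin, dmpaAbout_eq, dmpaAout]
        congr 1 <;> ring
  have h3BRout : HasDerivBoundAt (2 / (c ^ 2 * dmpaT p q δ))
      (dmpaP3BR r p q hR hB δ θin) θout :=
    hjoint hC hC' hA hA' (hmul hA hA' hR1 hR0') hzero hB0 hB1 hR1 hR0' hB1 hB0' hR0 hR1
      fun y => by
        rw [dmpaP3BR, dmpaD3_eq, dmpaAbin_eq, dmpaAin, dmpaAbout_eq, dmpaAout]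
        congr 1 <;> ring
  have h3RBout : HasDerivBoundAt (2 / (c ^ 2 * dmpaT p q δ))
      (dmpaP3RB r p q hR hB δ θin) θout :=
    hjoint hC hC' hA hA' hzero (hmul hAc hAc' hB1 hB0') hB0 hB1 hR1 hR0' hB1 hB0' hR0 hR1
      fun y => by
        rw [dmpaP3RB, dmpaD3_eq, dmpaAbin_eq, dmpaAin, dmpaAbout_eq, dmpaAout]
        congr 1 <;> ring
  simp only [dmpaF, add_comm _ (q * r)]
  exact ⟨hmix hp (by linarith) h1RR h1BR h3RRin h3BRin,
    hmix hp (by linarith) (hconst _ _) (hconst _ _) h3RRout h3BRout,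
    hmix hq (by linarith) (hconst _ _) (hconst _ _) h3RRin h3RBin,
    hmix hq (by linarith) h2RR h2BR h3RRout h3RBout⟩

end Estimates

/-- For `r ∈ (0,1)`, `p, q ≥ 0` with `p + q ≤ 1`, `p + q > 0`, and
`h_R, h_B ∈ (0,1)`: (i) for `δ` large enough all denominators of the DMPA limit map `F` are
strictly positive on `[0,1]²` and `F` is continuously differentiable there; (ii) each of the
four partial derivatives `∂F_i/∂θ_j` tends to `0` as `δ → ∞`, uniformly over `θ ∈ [0,1]²`;
(iii) there exists `δ* > 0` such that for all `δ > δ*` the Frobenius norm of the Jacobian of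
`F` is strictly less than `1` everywhere on `[0,1]²`. -/
theorem dmpa_jacobian_small_and_frobenius_norm_lt_one
    (r p q hR hB : ℝ)
    (hr : r ∈ Ioo (0 : ℝ) 1) (hp : 0 ≤ p) (hq : 0 ≤ q)
    (hpq : p + q ≤ 1) (hpq0 : 0 < p + q)
    (hhR : hR ∈ Ioo (0 : ℝ) 1) (hhB : hB ∈ Ioo (0 : ℝ) 1) :
    (∃ δ₀ > (0 : ℝ), ∀ δ > δ₀,
      (∀ θin ∈ Icc (0 : ℝ) 1, ∀ θout ∈ Icc (0 : ℝ) 1,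
        0 < dmpaDen1RR r p q hR hB δ θin ∧
        0 < dmpaDen1BR r p q hR hB δ θin ∧
        0 < dmpaDen2RR r p q hR δ θout ∧
        0 < dmpaDen2BR r p q hB δ θout ∧
        0 < dmpaD3 r p q hR hB δ θin θout) ∧
      ContDiffOn ℝ 1 (dmpaF r p q hR hB δ) (Icc (0 : ℝ) 1 ×ˢ Icc (0 : ℝ) 1)) ∧
    (∀ ε > (0 : ℝ), ∃ δ₁ > (0 : ℝ), ∀ δ > δ₁,
      ∀ θin ∈ Icc (0 : ℝ) 1, ∀ θout ∈ Icc (0 : ℝ) 1,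
        |deriv (fun x => (dmpaF r p q hR hB δ (x, θout)).1) θin| < ε ∧
        |deriv (fun y => (dmpaF r p q hR hB δ (θin, y)).1) θout| < ε ∧
        |deriv (fun x => (dmpaF r p q hR hB δ (x, θout)).2) θin| < ε ∧
        |deriv (fun y => (dmpaF r p q hR hB δ (θin, y)).2) θout| < ε) ∧
    (∃ δstar > (0 : ℝ), ∀ δ > δstar,
      ∀ θin ∈ Icc (0 : ℝ) 1, ∀ θout ∈ Icc (0 : ℝ) 1,
        Real.sqrt
          ((deriv (fun x => (dmpaF r p q hR hB δ (x, θout)).1) θin) ^ 2 +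
            (deriv (fun y => (dmpaF r p q hR hB δ (θin, y)).1) θout) ^ 2 +
            (deriv (fun x => (dmpaF r p q hR hB δ (x, θout)).2) θin) ^ 2 +
            (deriv (fun y => (dmpaF r p q hR hB δ (θin, y)).2) θout) ^ 2) < 1) := by
  have huniform : ∀ ε > (0 : ℝ), ∃ δ₁ > (0 : ℝ), ∀ δ > δ₁,
      ∀ θin ∈ Icc (0 : ℝ) 1, ∀ θout ∈ Icc (0 : ℝ) 1,
        |deriv (fun x => (dmpaF r p q hR hB δ (x, θout)).1) θin| < ε ∧
        |deriv (fun y => (dmpaF r p q hR hB δ (θin, y)).1) θout| < ε ∧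
        |deriv (fun x => (dmpaF r p q hR hB δ (x, θout)).2) θin| < ε ∧
        |deriv (fun y => (dmpaF r p q hR hB δ (θin, y)).2) θout| < ε := by
    intro ε hε
    obtain ⟨c, hc, hcR, hcB⟩ : ∃ c > 0, (c ≤ hR ∧ c ≤ 1 - hR) ∧ (c ≤ hB ∧ c ≤ 1 - hB) :=
      ⟨min (min hR (1 - hR)) (min hB (1 - hB)),
        lt_min (lt_min hhR.1 (sub_pos.2 hhR.2)) (lt_min hhB.1 (sub_pos.2 hhB.2)),
        le_min_iff.1 (min_le_left _ _), le_min_iff.1 (min_le_right _ _)⟩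
    refine ⟨4 / (c ^ 2 * (p + q) * ε), by positivity, fun δ hδ θin hin θout hout => ?_⟩
    have hδ0 : 0 < δ := lt_trans (by positivity) hδ
    have hsmall : 2 * (2 / (c ^ 2 * dmpaT p q δ)) < ε := by
      rw [gt_iff_lt, div_lt_iff₀ (by positivity)] at hδ
      have hT : 0 < dmpaT p q δ := by unfold dmpaT dmpaS; positivity
      rw [← mul_div_assoc, div_lt_iff₀ (by positivity)]
      have : 0 < ε * c ^ 2 := by positivity
      unfold dmpaT dmpaS
      linarith
    obtain ⟨h₁, h₂, h₃, h₄⟩ := dmpaF_partialDerivs_bound hr hp hq hpq hpq0 hδ0 hc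
      hcR.1 hcR.2 hcB.1 hcB.2 hin hout
    exact ⟨h₁.abs_deriv_le.trans_lt hsmall, h₂.abs_deriv_le.trans_lt hsmall,
      h₃.abs_deriv_le.trans_lt hsmall, h₄.abs_deriv_le.trans_lt hsmall⟩
  refine ⟨⟨1, one_pos, fun δ hδ => ?_⟩, huniform, ?_⟩
  · have hδ0 : 0 < δ := one_pos.trans hδ
    exact ⟨fun _ hin _ hout => dmpa_denominators_pos hr hpq0 hhR hhB hδ0 hin hout,
      contDiffOn_dmpaF hr hpq0 hhR hhB hδ0⟩
  · obtain ⟨δ₁, hδ₁, hbound⟩ := huniform (1 / 2) (by norm_num)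
    refine ⟨δ₁, hδ₁, fun δ hδ θin hin θout hout => ?_⟩
    have hsq {d : ℝ} (hd : |d| < 1 / 2) : d ^ 2 < (1 / 2) ^ 2 :=
      sq_lt_sq.2 (by rwa [abs_of_pos (by norm_num : (0 : ℝ) < 1 / 2)])
    obtain ⟨h₁, h₂, h₃, h₄⟩ := hbound δ hδ θin hin θout hout
    rw [Real.sqrt_lt' one_pos]
    linarith [hsq h₁, hsq h₂, hsq h₃, hsq h₄]
end
end

section
/- Let (Ω, 𝔉, μ) be a probability space with a filtration (𝔉_t)_{t ∈ ℕ}. Let F : ℝ² → ℝ² (with ℝ² carrying the Euclidean norm) be Lipschitz with constant L < 1, mapping the compact set K = [0,1]² into itself, and let x* ∈ K be its unique fixed point. Let (x_t)_{t ∈ ℕ} and (Y_t)_{t ∈ ℕ} be sequences of random variables with values in ℝ² such that: x_t is 𝔉_t-measurable and takes values in K for every t; there is a constant C with ‖Y_t‖ ≤ C almost surely for all t; x_{t+1} = x_t + (1/(t+1)) Y_t for all t; the conditional expectation satisfies E[Y_t | 𝔉_t] = F(x_t) − x_t + β_t for 𝔉_t-measurable random variables β_t; and Σ_t ‖β_t‖/(t+1)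 < ∞ almost surely. Then x_t converges to x* almost surely as t → ∞. -/
open MeasureTheory Filter Set

/-- A nonnegative sequence whose increments are at most `-a n * v n` plus the terms of a convergent
series tends to zero when `a` is nonnegative and `∑ a n` diverges. -/
theorem tendsto_zero_of_le_sub_mul_add {v a e : ℕ → ℝ} {s : ℝ}
    (hv : ∀ n, 0 ≤ v n) (ha : ∀ n, 0 ≤ a n)
    (ha_sum : Tendsto (fun n => ∑ k ∈ Finset.range n, a k) atTop atTop)
    (he : Tendsto (fun n => ∑ k ∈ Finset.range n, e k) atTop (nhds s))
    (hrec : ∀ n, v (n + 1) ≤ v n - a n * v n + e n) :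
    Tendsto v atTop (nhds 0) := by
  set S : ℕ → ℝ := fun n => ∑ k ∈ Finset.range n, e k with hS
  obtain ⟨B, hB⟩ := he.bddAbove_range
  have hSB : ∀ n, S n ≤ B := fun n => hB ⟨n, rfl⟩
  have hanti : Antitone fun n => v n - S n := antitone_nat_of_succ_le fun n => by
    have h1 := hrec n
    have h2 := mul_nonneg (ha n) (hv n)
    simp only [hS, Finset.sum_range_succ]
    linarith
  have hbdd : BddBelow (range fun n => v n - S n) := ⟨-B, by
    rintro _ ⟨n, rfl⟩
    have h1 := hv n
    have h2 := hSB n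
    simp only
    linarith⟩
  have hlim : Tendsto v atTop (nhds ((⨅ n, (v n - S n)) + s)) := by
    simpa using (tendsto_atTop_ciInf hanti hbdd).add he
  set l := (⨅ n, (v n - S n)) + s
  have hl : 0 ≤ l := ge_of_tendsto' hlim hv
  rcases hl.eq_or_lt with h | hpos
  · rwa [← h] at hlim
  obtain ⟨N, hN⟩ := eventually_atTop.1 (hlim.eventually (lt_mem_nhds (half_lt_self hpos)))
  have hdecr : ∀ n, N ≤ n → v n - S n + l / 2 * ∑ k ∈ Finset.range n, a k ≤
      v N - S N + l / 2 * ∑ k ∈ Finset.range N, a k := by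
    intro n hn
    induction n, hn using Nat.le_induction with
    | base => exact le_rfl
    | succ n hn ih =>
      refine le_trans ?_ ih
      have h1 := hrec n
      have h2 := mul_le_mul_of_nonneg_left (hN n hn).le (ha n)
      simp only [hS, Finset.sum_range_succ]
      linarith
  obtain ⟨n, hNn, hn⟩ := ((eventually_ge_atTop N).and ((ha_sum.const_mul_atTop
    (half_pos hpos)).eventually_gt_atTop
      (B + (v N - S N + l / 2 * ∑ k ∈ Finset.range N, a k)))).exists
  have h1 := hdecr n hNn
  have h2 := hSB n
  have h3 := hv n
  linarith

/-- A real martingale started at zero whose increments have square-summable almost sure bounds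
converges almost surely. -/
theorem MeasureTheory.Martingale.exists_ae_tendsto_of_summable_sq_bound
    {Ω : Type*} {m : MeasurableSpace Ω} {μ : Measure Ω} [IsProbabilityMeasure μ]
    {ℱ : Filtration ℕ m} {f : ℕ → Ω → ℝ} (hf : Martingale f ℱ μ) (h0 : f 0 = 0)
    {b : ℕ → ℝ} (hb : ∀ n, ∀ᵐ ω ∂μ, |f (n + 1) ω - f n ω| ≤ b n)
    (hb_sum : Summable fun n => b n ^ 2) :
    ∀ᵐ ω ∂μ, ∃ l, Tendsto (fun n => f n ω) atTop (nhds l) := by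
  have hf_meas : ∀ n, AEStronglyMeasurable (f n) μ := fun n => (hf.integrable n).1
  have hbdd : ∀ n, ∀ᵐ ω ∂μ, ‖f n ω‖ ≤ ∑ k ∈ Finset.range n, b k := by
    intro n
    induction n with
    | zero => simp [h0]
    | succ n ih =>
      filter_upwards [ih, hb n] with ω h1 h2
      rw [Finset.sum_range_succ]
      calc ‖f (n + 1) ω‖ = ‖f n ω + (f (n + 1) ω - f n ω)‖ := by simp
        _ ≤ _ := (norm_add_le _ _).trans (add_le_add h1 h2)
  have hLp : ∀ n, MemLp (f n) 2 μ := fun n => MemLp.of_bound (hf_meas n) _ (hbdd n)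
  have hstep : ∀ n, ∫ ω, f (n + 1) ω ^ 2 ∂μ ≤ ∫ ω, f n ω ^ 2 ∂μ + b n ^ 2 := by
    intro n
    have hd : MemLp (f (n + 1) - f n) 2 μ := (hLp _).sub (hLp n)
    have hprod : Integrable (f n * (f (n + 1) - f n)) μ := (hLp n).integrable_mul hd
    have hcross : ∫ ω, (f n * (f (n + 1) - f n)) ω ∂μ = 0 := by
      rw [← integral_condExp (ℱ.le n)]
      refine integral_eq_zero_of_ae ?_
      have hsub := condExp_sub (hf.integrable (n + 1)) (hf.integrable n) (ℱ n)
      filter_upwards [condExp_mul_of_stronglyMeasurable_left (hf.1 n) hprod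
        ((hf.integrable _).sub (hf.integrable n)), hsub, hf.2 n (n + 1) n.le_succ,
        hf.2 n n le_rfl] with ω h1 h2 h3 h4
      rw [h1, Pi.mul_apply, h2, Pi.sub_apply, h3, h4]
      simp
    have hsq : ∫ ω, (f (n + 1) - f n) ω ^ 2 ∂μ ≤ b n ^ 2 := by
      have : ∫ ω, (f (n + 1) - f n) ω ^ 2 ∂μ ≤ ∫ _, b n ^ 2 ∂μ := by
        refine integral_mono_ae hd.integrable_sq (integrable_const _) ?_
        filter_upwards [hb n] with ω h
        exact sq_le_sq' (neg_le_of_abs_le h) (le_of_abs_le h)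
      simpa using this
    have hexp : ∀ ω, f (n + 1) ω ^ 2 = f n ω ^ 2 + 2 * (f n * (f (n + 1) - f n)) ω
        + (f (n + 1) - f n) ω ^ 2 := fun ω => by
      simp only [Pi.mul_apply, Pi.sub_apply]; ring
    simp_rw [hexp]
    rw [integral_add (by exact (hLp n).integrable_sq.add (hprod.const_mul 2)) hd.integrable_sq,
      integral_add (hLp n).integrable_sq (hprod.const_mul 2), integral_const_mul, hcross]
    linarith
  have hsq : ∀ n, ∫ ω, f n ω ^ 2 ∂μ ≤ ∑ k ∈ Finset.range n, b k ^ 2 := by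
    intro n
    induction n with
    | zero => simp [h0]
    | succ n ih =>
      rw [Finset.sum_range_succ]
      exact (hstep n).trans (by gcongr)
  refine hf.submartingale.exists_ae_tendsto_of_bdd (R := (1 + ∑' k, b k ^ 2).toNNReal) fun n => ?_
  rw [eLpNorm_one_eq_lintegral_enorm, ← ofReal_integral_norm_eq_lintegral_enorm (hf.integrable n)]
  refine ENNReal.ofReal_le_ofReal ?_
  calc ∫ ω, ‖f n ω‖ ∂μ ≤ ∫ ω, (1 + f n ω ^ 2) ∂μ := by
        refine integral_mono (hf.integrable n).norm
          ((integrable_const _).add (hLp n).integrable_sq) fun ω => ?_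
        simp only [Real.norm_eq_abs]
        nlinarith [sq_nonneg (|f n ω| - 1), sq_abs (f n ω), abs_nonneg (f n ω)]
    _ = 1 + ∫ ω, f n ω ^ 2 ∂μ := by
        rw [integral_add (integrable_const _) (hLp n).integrable_sq]; simp
    _ ≤ 1 + ∑' k, b k ^ 2 := by
        gcongr
        exact (hsq n).trans (hb_sum.sum_le_tsum _ fun _ _ => sq_nonneg _)

/-- The series of conditionally centered terms `Z n - μ[Z n | ℱ n]` converges almost surely when
`Z n` is `ℱ (n + 1)`-measurable with square-summable almost sure bounds. -/
theorem exists_ae_tendsto_sum_sub_condExp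
    {Ω : Type*} {m : MeasurableSpace Ω} {μ : Measure Ω} [IsProbabilityMeasure μ]
    {ℱ : Filtration ℕ m} {Z : ℕ → Ω → ℝ} (hZ : ∀ n, StronglyMeasurable[ℱ (n + 1)] (Z n))
    {b : ℕ → ℝ} (hb : ∀ n, ∀ᵐ ω ∂μ, |Z n ω| ≤ b n)
    (hb_sum : Summable fun n => b n ^ 2) :
    ∀ᵐ ω ∂μ, ∃ l, Tendsto (fun n => ∑ k ∈ Finset.range n, (Z k ω - (μ[Z k | ℱ k]) ω))
      atTop (nhds l) := by
  set f : ℕ → Ω → ℝ := fun n => ∑ k ∈ Finset.range n, (Z k - μ[Z k | ℱ k]) with hfdef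
  have hZint : ∀ n, Integrable (Z n) μ := fun n =>
    Integrable.of_bound ((hZ n).mono (ℱ.le _)).aestronglyMeasurable (b n) (hb n)
  have hint : ∀ n, Integrable (f n) μ := fun n =>
    integrable_finsetSum' _ fun k _ => (hZint k).sub integrable_condExp
  have hdiff : ∀ n, f (n + 1) - f n = Z n - μ[Z n | ℱ n] := fun n => by
    simp only [hfdef, Finset.sum_range_succ, add_sub_cancel_left]
  have hmart : Martingale f ℱ μ := by
    refine martingale_of_condExp_sub_eq_zero_nat (fun n => ?_) hint fun n => ?_
    · refine Finset.stronglyMeasurable_sum _ fun k hk => ?_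
      have hk : k + 1 ≤ n := Finset.mem_range.1 hk
      exact ((hZ k).mono (ℱ.mono hk)).sub
        (stronglyMeasurable_condExp.mono (ℱ.mono (k.le_succ.trans hk)))
    · rw [hdiff]
      refine (condExp_sub (hZint n) integrable_condExp _).trans ?_
      rw [condExp_of_stronglyMeasurable (ℱ.le n) stronglyMeasurable_condExp integrable_condExp,
        sub_self]
  have := hmart.exists_ae_tendsto_of_summable_sq_bound (by simp [hfdef])
    (b := fun n => 2 * b n) (fun n => ?_) (by simpa [mul_pow] using hb_sum.mul_left (2 ^ 2))
  · simpa [hfdef] using this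
  · filter_upwards [hb n, ae_bdd_abs_condExp_of_ae_bdd_abs (m := ℱ n) (hb n)] with ω h1 h2
    have h3 := congrFun (hdiff n) ω
    simp only [Pi.sub_apply] at h3
    rw [h3]
    exact (abs_sub _ _).trans (by linarith)

/-- The series of inner products of a predictable sequence `u` with the conditionally centered
noise `Y n - μ[Y n | ℱ n]` converges almost surely when `Y` is bounded and `u` is
square-summably bounded. -/
theorem exists_ae_tendsto_sum_inner_sub_inner_condExp
    {Ω E : Type*} [NormedAddCommGroup E] [InnerProductSpace ℝ E] [CompleteSpace E]
    {m : MeasurableSpace Ω} {μ : Measure Ω} [IsProbabilityMeasure μ]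
    {ℱ : Filtration ℕ m} {u Y : ℕ → Ω → E} (hu : ∀ n, StronglyMeasurable[ℱ n] (u n))
    (hY : ∀ n, StronglyMeasurable[ℱ (n + 1)] (Y n))
    {r : ℕ → ℝ} (hur : ∀ n ω, ‖u n ω‖ ≤ r n) (hr_sum : Summable fun n => r n ^ 2)
    {C : ℝ} (hC : ∀ n, ∀ᵐ ω ∂μ, ‖Y n ω‖ ≤ C) :
    ∀ᵐ ω ∂μ, ∃ l, Tendsto (fun n => ∑ k ∈ Finset.range n,
      (inner ℝ (u k ω) (Y k ω) - inner ℝ (u k ω) ((μ[Y k | ℱ k]) ω))) atTop (nhds l) := by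
  have hY_int : ∀ n, Integrable (Y n) μ := fun n =>
    Integrable.of_bound ((hY n).mono (ℱ.le _)).aestronglyMeasurable C (hC n)
  have hZ : ∀ n, StronglyMeasurable[ℱ (n + 1)] fun ω => (inner ℝ (u n ω) (Y n ω) : ℝ) := fun n =>
    ((hu n).mono (ℱ.mono n.le_succ)).inner (hY n)
  have hZ_bdd : ∀ n, ∀ᵐ ω ∂μ, |(inner ℝ (u n ω) (Y n ω) : ℝ)| ≤ r n * C := fun n => by
    filter_upwards [hC n] with ω h
    exact (abs_real_inner_le_norm _ _).trans (mul_le_mul (hur n ω) h (norm_nonneg _)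
      ((norm_nonneg _).trans (hur n ω)))
  have hb_sum : Summable fun n => (r n * C) ^ 2 := by
    simpa only [mul_pow] using hr_sum.mul_right (C ^ 2)
  have hcond : ∀ n, μ[fun ω => (inner ℝ (u n ω) (Y n ω) : ℝ) | ℱ n] =ᵐ[μ]
      fun ω => inner ℝ (u n ω) ((μ[Y n | ℱ n]) ω) := fun n =>
    condExp_bilin_of_stronglyMeasurable_left (innerSL ℝ) (hu n)
      (Integrable.of_bound ((hZ n).mono (ℱ.le _)).aestronglyMeasurable _ (hZ_bdd n)) (hY_int n)
  filter_upwards [exists_ae_tendsto_sum_sub_condExp hZ hZ_bdd hb_sum, ae_all_iff.2 hcond]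
    with ω h hc
  simpa only [hc] using h

theorem summable_inv_nat_succ_sq : Summable fun n : ℕ => ((n + 1 : ℝ)⁻¹) ^ 2 := by
  simpa using (summable_nat_add_iff 1).2 (Real.summable_nat_pow_inv.2 one_lt_two)

/-- A bounded sequence with increments `(n + 1)⁻¹ • y n` converges to the fixed point `p` of the
contraction `F` when `y n` differs from the drift `F (x n) - x n + β n` by noise whose
weighted inner products with `x n - p` form a convergent series. -/
theorem LipschitzWith.tendsto_fixedPoint_of_noisy_recursion
    {E : Type*} [NormedAddCommGroup E] [InnerProductSpace ℝ E]
    {F : E → E} {L : NNReal} (hF : LipschitzWith L F) (hL : L < 1) {p : E} (hp : F p = p)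
    {x y β : ℕ → E} {R C l : ℝ} (hR : ∀ n, ‖x n - p‖ ≤ R) (hC : ∀ n, ‖y n‖ ≤ C)
    (hrec : ∀ n : ℕ, x (n + 1) = x n + (n + 1 : ℝ)⁻¹ • y n)
    (hβ : Summable fun n : ℕ => ‖β n‖ / (n + 1))
    (hl : Tendsto (fun n => ∑ k ∈ Finset.range n, (inner ℝ ((k + 1 : ℝ)⁻¹ • (x k - p)) (y k)
      - inner ℝ ((k + 1 : ℝ)⁻¹ • (x k - p)) (F (x k) - x k + β k))) atTop (nhds l)) :
    Tendsto x atTop (nhds p) := by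
  have hpos : ∀ n : ℕ, (0 : ℝ) < n + 1 := fun n => by positivity
  have hL' : (L : ℝ) < 1 := hL
  have he := ((hl.const_mul 2).add (hβ.mul_left (2 * R)).hasSum.tendsto_sum_nat).add
    (summable_inv_nat_succ_sq.mul_left (C ^ 2)).hasSum.tendsto_sum_nat
  simp only [Finset.mul_sum, ← Finset.sum_add_distrib] at he
  have ha_sum : Tendsto (fun n => ∑ k ∈ Finset.range n, 2 * (1 - (L : ℝ)) * (1 / (k + 1 : ℝ)))
      atTop atTop := by
    simp only [← Finset.mul_sum]
    exact Real.tendsto_sum_range_one_div_nat_succ_atTop.const_mul_atTop (by linarith)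
  have hV : Tendsto (fun n => ‖x n - p‖ ^ 2) atTop (nhds 0) := by
    refine tendsto_zero_of_le_sub_mul_add (fun n => sq_nonneg _)
      (fun n => mul_nonneg (by linarith) (one_div_pos.2 (hpos n)).le) ha_sum he fun n => ?_
    have hexp : ‖x (n + 1) - p‖ ^ 2 = ‖x n - p‖ ^ 2 +
        2 * ((n + 1 : ℝ)⁻¹ * inner ℝ (x n - p) (y n)) + ((n + 1 : ℝ)⁻¹) ^ 2 * ‖y n‖ ^ 2 := by
      rw [hrec, add_sub_right_comm, norm_add_sq_real, real_inner_smul_right, norm_smul, mul_pow,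
        Real.norm_eq_abs, sq_abs]
    have hy : ‖y n‖ ^ 2 ≤ C ^ 2 := pow_le_pow_left₀ (norm_nonneg _) (hC n) 2
    have hdrift : inner ℝ (x n - p) (F (x n) - x n + β n) ≤
        -(1 - L) * ‖x n - p‖ ^ 2 + R * ‖β n‖ := by
      have hsplit : F (x n) - x n + β n = (F (x n) - F p) - (x n - p) + β n := by
        rw [hp]; abel
      rw [hsplit, inner_add_right, inner_sub_right, real_inner_self_eq_norm_sq]
      have h1 := real_inner_le_norm (x n - p) (F (x n) - F p)
      have h2 := mul_le_mul_of_nonneg_left (hF.norm_sub_le (x n) p) (norm_nonneg (x n - p))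
      have h3 := real_inner_le_norm (x n - p) (β n)
      have h4 := mul_le_mul_of_nonneg_right (hR n) (norm_nonneg (β n))
      linarith
    have h1 := mul_le_mul_of_nonneg_left hdrift (inv_nonneg.2 (hpos n).le)
    have h2 := mul_le_mul_of_nonneg_left hy (sq_nonneg ((n + 1 : ℝ)⁻¹))
    rw [hexp, real_inner_smul_left, real_inner_smul_left, one_div, div_eq_mul_inv]
    linarith
  rw [tendsto_iff_norm_sub_tendsto_zero]
  simpa [Real.sqrt_sq (norm_nonneg _)] using hV.sqrt

theorem EuclideanSpace.norm_sub_le_two_of_mem_unitSquare {x y : EuclideanSpace ℝ (Fin 2)}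
    (hx : ∀ i, x i ∈ Icc (0 : ℝ) 1) (hy : ∀ i, y i ∈ Icc (0 : ℝ) 1) : ‖x - y‖ ≤ 2 := by
  have hi : ∀ i, (x i - y i) ^ 2 ≤ 1 := fun i => by
    obtain ⟨hx0, hx1⟩ := hx i
    obtain ⟨hy0, hy1⟩ := hy i
    nlinarith
  refine le_of_sq_le_sq ?_ (by norm_num)
  rw [EuclideanSpace.real_norm_sq_eq, Fin.sum_univ_two]
  simp only [PiLp.sub_apply]
  linarith [hi 0, hi 1]

/-- Stochastic-approximation convergence: let `F : ℝ² → ℝ²` (Euclidean norm)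
be Lipschitz with constant `L < 1` mapping `K = [0,1]²` into itself, with unique fixed point
`x* ∈ K`.  If `(x_t)` is adapted, `K`-valued, `‖Y_t‖ ≤ C` a.s., `x_{t+1} = x_t + Y_t/(t+1)`,
`E[Y_t | 𝔉_t] = F(x_t) − x_t + β_t` with `𝔉_t`-measurable `β_t` and
`Σ_t ‖β_t‖/(t+1) < ∞` a.s., then `x_t → x*` almost surely. -/
theorem stochastic_approximation_converges_to_fixed_point
    {Ω : Type*} {m : MeasurableSpace Ω} {μ : Measure Ω} [IsProbabilityMeasure μ]
    (𝔉 : Filtration ℕ m)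
    (F : EuclideanSpace ℝ (Fin 2) → EuclideanSpace ℝ (Fin 2))
    (K : Set (EuclideanSpace ℝ (Fin 2)))
    (hK : K = {x : EuclideanSpace ℝ (Fin 2) | ∀ i, x i ∈ Icc (0 : ℝ) 1})
    (L : NNReal) (hL : L < 1) (hF : LipschitzWith L F)
    (hFK : Set.MapsTo F K K)
    (xstar : EuclideanSpace ℝ (Fin 2)) (hxstarK : xstar ∈ K)
    (hfix : F xstar = xstar) (huniq : ∀ y, F y = y → y = xstar)
    (x Y β : ℕ → Ω → EuclideanSpace ℝ (Fin 2))
    (hx_meas : ∀ t, Measurable[𝔉 t] (x t))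
    (hxK : ∀ t ω, x t ω ∈ K)
    (hY_meas : ∀ t, Measurable (Y t))
    (C : ℝ) (hC : ∀ t, ∀ᵐ ω ∂μ, ‖Y t ω‖ ≤ C)
    (hrec : ∀ t ω, x (t + 1) ω = x t ω + ((t + 1 : ℝ))⁻¹ • Y t ω)
    (hβ_meas : ∀ t, Measurable[𝔉 t] (β t))
    (hcond : ∀ t, μ[Y t | 𝔉 t] =ᵐ[μ] fun ω => F (x t ω) - x t ω + β t ω)
    (hβ_sum : ∀ᵐ ω ∂μ, Summable fun t => ‖β t ω‖ / (t + 1)) :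
    ∀ᵐ ω ∂μ, Tendsto (fun t => x t ω) atTop (nhds xstar) := by
  have hdiam : ∀ t ω, ‖x t ω - xstar‖ ≤ 2 := fun t ω => by
    have hxt := hxK t ω
    rw [hK] at hxt hxstarK
    exact EuclideanSpace.norm_sub_le_two_of_mem_unitSquare hxt hxstarK
  have hpos : ∀ t : ℕ, (0 : ℝ) < t + 1 := fun t => by positivity
  have hx : ∀ t, StronglyMeasurable[𝔉 t] (x t) := fun t => (hx_meas t).stronglyMeasurable
  have hY : ∀ t, StronglyMeasurable[𝔉 (t + 1)] (Y t) := fun t => by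
    have hY_eq : Y t = fun ω => (t + 1 : ℝ) • (x (t + 1) ω - x t ω) := by
      ext1 ω
      rw [hrec, add_sub_cancel_left, smul_smul, mul_inv_cancel₀ (hpos t).ne', one_smul]
    rw [hY_eq]
    exact ((hx (t + 1)).sub ((hx t).mono (𝔉.mono t.le_succ))).const_smul (t + 1 : ℝ)
  have hu : ∀ t : ℕ, StronglyMeasurable[𝔉 t] fun ω => (t + 1 : ℝ)⁻¹ • (x t ω - xstar) := fun t =>
    ((hx t).sub stronglyMeasurable_const).const_smul (t + 1 : ℝ)⁻¹
  have hu_bdd : ∀ (t : ℕ) ω, ‖(t + 1 : ℝ)⁻¹ • (x t ω - xstar)‖ ≤ (t + 1 : ℝ)⁻¹ * 2 := fun t ω => by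
    rw [norm_smul, Real.norm_of_nonneg (inv_nonneg.2 (hpos t).le)]
    exact mul_le_mul_of_nonneg_left (hdiam t ω) (inv_nonneg.2 (hpos t).le)
  have hsum : Summable fun t : ℕ => ((t + 1 : ℝ)⁻¹ * 2) ^ 2 := by
    simpa only [mul_pow] using summable_inv_nat_succ_sq.mul_right (2 ^ 2)
  filter_upwards [exists_ae_tendsto_sum_inner_sub_inner_condExp hu hY hu_bdd hsum hC,
    ae_all_iff.2 hcond, ae_all_iff.2 hC, hβ_sum] with ω ⟨l, hl⟩ hc hCω hβ
  simp only [hc] at hl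
  exact hF.tendsto_fixedPoint_of_noisy_recursion hL hfix (fun t => hdiam t ω) hCω
    (fun t => hrec t ω) hβ hl
end

section
/- Let E be a real inner product space, let F : E → E be Lipschitz with constant L < 1, and let x* ∈ E be a fixed point of F. Let x : ℝ → E be a function such that for every t ≥ 0, x has derivative F(x(t)) − x(t) at t (i.e. x solves the ODE ẋ = F(x) − x). Then for all t ≥ 0, ‖x(t) − x*‖ ≤ exp(−(1−L) t) · ‖x(0) − x*‖; in particular x(t) → x* as t → ∞. -/
open Filter

/-- If `‖v' + v‖ ≤ K * ‖v‖` on `[0, ∞)`, then `v` grows at most like `exp ((K - 1) * t)`. -/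
lemma norm_le_exp_mul_of_norm_deriv_add_self_le
    {E : Type*} [NormedAddCommGroup E] [NormedSpace ℝ E] {v v' : ℝ → E} {K : ℝ}
    (hv : ∀ t, 0 ≤ t → HasDerivAt v (v' t) t)
    (bound : ∀ t, 0 ≤ t → ‖v' t + v t‖ ≤ K * ‖v t‖) {t : ℝ} (ht : 0 ≤ t) :
    ‖v t‖ ≤ Real.exp (-(1 - K) * t) * ‖v 0‖ := by
  have hderiv : ∀ s, 0 ≤ s →
      HasDerivAt (fun s => Real.exp s • v s) (Real.exp s • (v' s + v s)) s := fun s hs => by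
    rw [smul_add]
    exact (Real.hasDerivAt_exp s).smul (hv s hs)
  have key := norm_le_gronwallBound_of_norm_deriv_right_le (K := K) (ε := 0) (δ := ‖v 0‖)
    (fun s hs => (hderiv s hs.1).continuousAt.continuousWithinAt)
    (fun s hs => (hderiv s hs.1).hasDerivWithinAt) (by simp)
    (fun s hs => by
      rw [norm_smul, norm_smul, Real.norm_eq_abs, Real.abs_exp, add_zero, mul_left_comm]
      exact mul_le_mul_of_nonneg_left (bound s hs.1) (Real.exp_pos s).le)
    t (Set.right_mem_Icc.mpr ht)
  rw [gronwallBound_ε0, norm_smul, Real.norm_eq_abs, Real.abs_exp, sub_zero] at key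
  calc ‖v t‖ = Real.exp (-t) * (Real.exp t * ‖v t‖) := by
        rw [← mul_assoc, ← Real.exp_add, neg_add_cancel, Real.exp_zero, one_mul]
    _ ≤ Real.exp (-t) * (‖v 0‖ * Real.exp (K * t)) := by gcongr
    _ = Real.exp (-(1 - K) * t) * ‖v 0‖ := by
        rw [mul_left_comm, ← Real.exp_add, mul_comm]
        ring_nf

/-- Let `E` be a real inner product space, `F : E → E` Lipschitz with
constant `L < 1`, and `x*` a fixed point of `F`.  If `x : ℝ → E` solves the ODE
`ẋ = F(x) − x` for `t ≥ 0`, then `‖x(t) − x*‖ ≤ exp(−(1−L) t) ‖x(0) − x*‖` for all `t ≥ 0`;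
in particular `x(t) → x*` as `t → ∞`. -/
theorem ode_contraction_drift_exponential_stability
    {E : Type*} [NormedAddCommGroup E] [InnerProductSpace ℝ E]
    (F : E → E) (L : NNReal) (hL : L < 1) (hF : LipschitzWith L F)
    (xstar : E) (hfix : F xstar = xstar)
    (x : ℝ → E) (hx : ∀ t : ℝ, 0 ≤ t → HasDerivAt x (F (x t) - x t) t) :
    (∀ t : ℝ, 0 ≤ t →
      ‖x t - xstar‖ ≤ Real.exp (-(1 - (L : ℝ)) * t) * ‖x 0 - xstar‖) ∧
    Tendsto x atTop (nhds xstar) := by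
  have decay : ∀ t : ℝ, 0 ≤ t →
      ‖x t - xstar‖ ≤ Real.exp (-(1 - (L : ℝ)) * t) * ‖x 0 - xstar‖ := fun t ht =>
    norm_le_exp_mul_of_norm_deriv_add_self_le (v := fun s => x s - xstar)
      (fun s hs => (hx s hs).sub_const xstar)
      (fun s _ => by simpa [hfix] using hF.norm_sub_le (x s) xstar) ht
  refine ⟨decay, ?_⟩
  have hrate : -(1 - (L : ℝ)) < 0 := neg_lt_zero.mpr (sub_pos.mpr (mod_cast hL))
  have hlim : Tendsto (fun t : ℝ => Real.exp (-(1 - (L : ℝ)) * t) * ‖x 0 - xstar‖)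
      atTop (nhds 0) := by
    simpa using (Real.tendsto_exp_atBot.comp
      (tendsto_id.const_mul_atTop_of_neg hrate)).mul_const ‖x 0 - xstar‖
  rw [tendsto_iff_norm_sub_tendsto_zero]
  exact squeeze_zero' (Eventually.of_forall fun _ => norm_nonneg _)
    ((eventually_ge_atTop 0).mono decay) hlim
end
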